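/- If d ≤ 5, then the surjective F-algebra homomorphism μ : F[x_1,…,x_d] → e*_0 T e*_0 sending x_i ↦ e*_0 τ_i(a) e*_0 for 1 ≤ i ≤ d is an isomorphism. -/

import Mathlib

open Polynomial

noncomputable section

/-- The polynomial `τ_i = (λ−θ_0)(λ−θ_1)⋯(λ−θ_{i−1})`. -/
def tauPoly {F : Type*} [Field F] (θ : ℕ → F) (i : ℕ) : Polynomial F :=
  ∏ j ∈ Finset.range i, (X - C (θ j))

/-- The polynomial `η_i = (λ−θ_d)(λ−θ_{d−1})⋯(λ−θ_{d−i+1})`. -/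
def etaPoly {F : Type*} [Field F] (d : ℕ) (θ : ℕ → F) (i : ℕ) : Polynomial F :=
  ∏ j ∈ Finset.range i, (X - C (θ (d - j)))

/-- Generators of the algebra `T`: `a`, `a*`, `e_0,…,e_d`, `e*_0,…,e*_d`. -/
inductive TGen (d : ℕ) : Type
  | a : TGen d
  | astar : TGen d
  | e : Fin (d + 1) → TGen d
  | estar : Fin (d + 1) → TGen d

/-- The defining relations of the algebra `T`. -/
inductive TRel (F : Type*) [Field F] (d : ℕ) (θ θs : ℕ → F) :
    FreeAlgebra F (TGen d) → FreeAlgebra F (TGen d) → Prop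
  | ee (i j : Fin (d + 1)) :
      TRel F d θ θs (FreeAlgebra.ι F (TGen.e i) * FreeAlgebra.ι F (TGen.e j))
        (if i = j then FreeAlgebra.ι F (TGen.e i) else 0)
  | eses (i j : Fin (d + 1)) :
      TRel F d θ θs (FreeAlgebra.ι F (TGen.estar i) * FreeAlgebra.ι F (TGen.estar j))
        (if i = j then FreeAlgebra.ι F (TGen.estar i) else 0)
  | sum_e : TRel F d θ θs (∑ i : Fin (d + 1), FreeAlgebra.ι F (TGen.e i)) 1
  | sum_estar : TRel F d θ θs (∑ i : Fin (d + 1), FreeAlgebra.ι F (TGen.estar i)) 1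
  | a_eq : TRel F d θ θs (FreeAlgebra.ι F TGen.a)
      (∑ i : Fin (d + 1), θ (i : ℕ) • FreeAlgebra.ι F (TGen.e i))
  | astar_eq : TRel F d θ θs (FreeAlgebra.ι F TGen.astar)
      (∑ i : Fin (d + 1), θs (i : ℕ) • FreeAlgebra.ι F (TGen.estar i))
  | trid (i j : Fin (d + 1)) (k : ℕ) (hk : k ≤ d)
      (h : k < max ((i : ℕ) - (j : ℕ)) ((j : ℕ) - (i : ℕ))) :
      TRel F d θ θs (FreeAlgebra.ι F (TGen.estar i) * FreeAlgebra.ι F TGen.a ^ k *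
        FreeAlgebra.ι F (TGen.estar j)) 0
  | tridstar (i j : Fin (d + 1)) (k : ℕ) (hk : k ≤ d)
      (h : k < max ((i : ℕ) - (j : ℕ)) ((j : ℕ) - (i : ℕ))) :
      TRel F d θ θs (FreeAlgebra.ι F (TGen.e i) * FreeAlgebra.ι F TGen.astar ^ k *
        FreeAlgebra.ι F (TGen.e j)) 0

/-- The `F`-algebra `T` presented by the above generators and relations. -/
abbrev TAlg (F : Type*) [Field F] (d : ℕ) (θ θs : ℕ → F) : Type _ :=
  RingQuot (TRel F d θ θs)

/-- The image in `T` of a generator. -/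
def tgen (F : Type*) [Field F] (d : ℕ) (θ θs : ℕ → F) (g : TGen d) : TAlg F d θ θs :=
  RingQuot.mkAlgHom F (TRel F d θ θs) (FreeAlgebra.ι F g)

/-- The element `a` of `T`. -/
def aT (F : Type*) [Field F] (d : ℕ) (θ θs : ℕ → F) : TAlg F d θ θs :=
  tgen F d θ θs TGen.a

/-- The element `a*` of `T`. -/
def asT (F : Type*) [Field F] (d : ℕ) (θ θs : ℕ → F) : TAlg F d θ θs :=
  tgen F d θ θs TGen.astar

/-- The element `e_i` of `T` (defined to be `0` for `i > d`). -/
def eT (F : Type*) [Field F] (d : ℕ) (θ θs : ℕ → F) (i : ℕ) : TAlg F d θ θs :=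
  if h : i < d + 1 then tgen F d θ θs (TGen.e ⟨i, h⟩) else 0

/-- The element `e*_i` of `T` (defined to be `0` for `i > d`). -/
def esT (F : Type*) [Field F] (d : ℕ) (θ θs : ℕ → F) (i : ℕ) : TAlg F d θ θs :=
  if h : i < d + 1 then tgen F d θ θs (TGen.estar ⟨i, h⟩) else 0

/-- Conditions (i) and (iii): the `θ_i` are mutually distinct, the `θ*_i` are mutually
distinct, and the expressions `(θ_{i-2}−θ_{i+1})/(θ_{i-1}−θ_i)`,
`(θ*_{i-2}−θ*_{i+1})/(θ*_{i-1}−θ*_i)` are equal and independent of `i` for `2 ≤ i ≤ d−1`. -/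
def EigCond (F : Type*) [Field F] (d : ℕ) (θ θs : ℕ → F) : Prop :=
  (∀ i j, i ≤ d → j ≤ d → i ≠ j → θ i ≠ θ j) ∧
  (∀ i j, i ≤ d → j ≤ d → i ≠ j → θs i ≠ θs j) ∧
  ∃ β : F, ∀ i, 2 ≤ i → i + 1 ≤ d →
    θ (i - 2) - θ (i + 1) = β * (θ (i - 1) - θ i) ∧
    θs (i - 2) - θs (i + 1) = β * (θs (i - 1) - θs i)

/-- The subalgebra `D` of `T` generated by `a`, as an `F`-subspace. -/
def Dsub (F : Type*) [Field F] (d : ℕ) (θ θs : ℕ → F) : Submodule F (TAlg F d θ θs) :=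
  Subalgebra.toSubmodule (Algebra.adjoin F {aT F d θ θs})

/-- The subalgebra `D*` of `T` generated by `a*`, as an `F`-subspace. -/
def DsSub (F : Type*) [Field F] (d : ℕ) (θ θs : ℕ → F) : Submodule F (TAlg F d θ θs) :=
  Subalgebra.toSubmodule (Algebra.adjoin F {asT F d θ θs})

end

noncomputable section

/-- A tridiagonal system on `V` of diameter `d`, with data `(A; {E_i}; A*; {E*_i})`,
eigenvalue sequence `θ` and dual eigenvalue sequence `θs`.  The families `E`, `Es` are the
orderings of the primitive idempotents of `A`, `A*` (so the `E_i V` are the eigenspaces of the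
diagonalizable map `A`, ordered so that the tridiagonal conditions hold, and similarly for
`A*`), and the last condition is the irreducibility condition (iv). -/
def IsTDSystem (F : Type*) [Field F] (V : Type*) [AddCommGroup V] [Module F V]
    (d : ℕ) (A As : V →ₗ[F] V) (E Es : ℕ → (V →ₗ[F] V)) (θ θs : ℕ → F) : Prop :=
  FiniteDimensional F V ∧ 0 < Module.finrank F V ∧
  (∀ i j, i ≤ d → j ≤ d → i ≠ j → θ i ≠ θ j) ∧
  (∀ i j, i ≤ d → j ≤ d → i ≠ j → θs i ≠ θs j) ∧
  (∀ i, i ≤ d → E i ≠ 0) ∧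
  (∀ i, i ≤ d → Es i ≠ 0) ∧
  (∀ i j, i ≤ d → j ≤ d → E i ∘ₗ E j = if i = j then E i else 0) ∧
  (∀ i j, i ≤ d → j ≤ d → Es i ∘ₗ Es j = if i = j then Es i else 0) ∧
  (∑ i ∈ Finset.range (d + 1), E i) = LinearMap.id ∧
  (∑ i ∈ Finset.range (d + 1), Es i) = LinearMap.id ∧
  A = ∑ i ∈ Finset.range (d + 1), θ i • E i ∧
  As = ∑ i ∈ Finset.range (d + 1), θs i • Es i ∧
  (∀ i, i ≤ d → Submodule.map As (LinearMap.range (E i)) ≤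
    (if i = 0 then ⊥ else LinearMap.range (E (i - 1))) ⊔ LinearMap.range (E i) ⊔
      (if i = d then ⊥ else LinearMap.range (E (i + 1)))) ∧
  (∀ i, i ≤ d → Submodule.map A (LinearMap.range (Es i)) ≤
    (if i = 0 then ⊥ else LinearMap.range (Es (i - 1))) ⊔ LinearMap.range (Es i) ⊔
      (if i = d then ⊥ else LinearMap.range (Es (i + 1)))) ∧
  (∀ W : Submodule F V, (∀ w ∈ W, A w ∈ W) → (∀ w ∈ W, As w ∈ W) → W = ⊥ ∨ W = ⊤)

/-- A sharp tridiagonal system with parameter array `(θ; θs; ζ)`:  a tridiagonal system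
which is sharp (`dim E*_0 V = 1`) and whose split sequence is `ζ`, i.e.
`E*_0 τ_i(A) E*_0 = ζ_i E*_0 / ((θ*_0−θ*_1)⋯(θ*_0−θ*_i))` for `0 ≤ i ≤ d`. -/
def SharpTDWithArray (F : Type*) [Field F] (V : Type*) [AddCommGroup V] [Module F V]
    (d : ℕ) (A As : V →ₗ[F] V) (E Es : ℕ → (V →ₗ[F] V)) (θ θs ζ : ℕ → F) : Prop :=
  IsTDSystem F V d A As E Es θ θs ∧
  Module.finrank F (LinearMap.range (Es 0)) = 1 ∧
  ∀ i, i ≤ d → Es 0 ∘ₗ (Polynomial.aeval A (tauPoly θ i)) ∘ₗ Es 0 =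
    (ζ i / ∏ h ∈ Finset.Icc 1 i, (θs 0 - θs h)) • Es 0

/-- The action of an element `x` of `T` on a `T`-module `M`, as an `F`-linear map. -/
def actL {F : Type*} [Field F] {d : ℕ} {θ θs : ℕ → F} {M : Type*} [AddCommGroup M]
    [Module F M] [Module (TAlg F d θ θs) M] [IsScalarTower F (TAlg F d θ θs) M]
    (x : TAlg F d θ θs) : M →ₗ[F] M where
  toFun m := x • m
  map_add' := smul_add x
  map_smul' c m := (smul_comm c x m).symm

/-- The `F`-linear map `T → M`, `t ↦ t • v`, for a vector `v` of a `T`-module `M`. -/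
def applyVec {F : Type*} [Field F] {d : ℕ} {θ θs : ℕ → F} {M : Type*} [AddCommGroup M]
    [Module F M] [Module (TAlg F d θ θs) M] [IsScalarTower F (TAlg F d θ θs) M]
    (v : M) : TAlg F d θ θs →ₗ[F] M where
  toFun t := t • v
  map_add' x y := add_smul x y v
  map_smul' c t := smul_assoc c t v

/-- The `F`-subspace `e*_0 T e*_0` of `T`. -/
def corner (F : Type*) [Field F] (d : ℕ) (θ θs : ℕ → F) : Submodule F (TAlg F d θ θs) :=
  LinearMap.range ((LinearMap.mulLeft F (esT F d θ θs 0)).comp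
    (LinearMap.mulRight F (esT F d θ θs 0)))

/-- The properties characterizing the homomorphism `μ : F[x_1,…,x_d] → e*_0 T e*_0`:
it is `F`-linear, unital (with `1 ↦ e*_0`, the identity of `e*_0Te*_0`), multiplicative,
sends `x_i ↦ e*_0 τ_i(a) e*_0` for `1 ≤ i ≤ d`, and is onto `e*_0 T e*_0`. -/
def MuProps (F : Type*) [Field F] (d : ℕ) (θ θs : ℕ → F)
    (μ : MvPolynomial (Fin d) F →ₗ[F] TAlg F d θ θs) : Prop :=
  μ 1 = esT F d θ θs 0 ∧
  (∀ p q, μ (p * q) = μ p * μ q) ∧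
  (∀ i : Fin d, μ (MvPolynomial.X i) =
    esT F d θ θs 0 * (Polynomial.aeval (aT F d θ θs) (tauPoly θ ((i : ℕ) + 1))) *
      esT F d θ θs 0) ∧
  LinearMap.range μ = corner F d θ θs

/-- Conditions (ii) on the split sequence: `ζ_0 = 1`, `ζ_d ≠ 0` and
`Σ_{i=0}^d η_{d−i}(θ_0) η*_{d−i}(θ*_0) ζ_i ≠ 0`. -/
def ZetaCond (F : Type*) [Field F] (d : ℕ) (θ θs : ℕ → F) (ζ : ℕ → F) : Prop :=
  ζ 0 = 1 ∧ ζ d ≠ 0 ∧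
  (∑ i ∈ Finset.range (d + 1),
    (etaPoly d θ (d - i)).eval (θ 0) * (etaPoly d θs (d - i)).eval (θs 0) * ζ i) ≠ 0

/-- The element `g_i = e*_0 τ_i(a) e*_0 − ζ_i e*_0/((θ*_0−θ*_1)⋯(θ*_0−θ*_i))` of `T`. -/
def gElt (F : Type*) [Field F] (d : ℕ) (θ θs : ℕ → F) (ζ : ℕ → F) (i : ℕ) :
    TAlg F d θ θs :=
  esT F d θ θs 0 * (Polynomial.aeval (aT F d θ θs) (tauPoly θ i)) * esT F d θ θs 0 -
    (ζ i / ∏ h ∈ Finset.Icc 1 i, (θs 0 - θs h)) • esT F d θ θs 0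

/-- The left ideal `J = T(1−e*_0) + Σ_{i=1}^d T g_i` of `T`, as a submodule of `T` over
itself (with the left regular action). -/
def Jideal (F : Type*) [Field F] (d : ℕ) (θ θs : ℕ → F) (ζ : ℕ → F) :
    Submodule (TAlg F d θ θs) (TAlg F d θ θs) :=
  Submodule.span (TAlg F d θ θs)
    ({1 - esT F d θ θs 0} ∪ (gElt F d θ θs ζ '' Set.Icc 1 d))

/-- The `F`-subspace `D D* D D* D ⋯ D D* D` of `T` with `n+1` factors `D`. -/
def DDchain (F : Type*) [Field F] (d : ℕ) (θ θs : ℕ → F) : ℕ → Submodule F (TAlg F d θ θs)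
  | 0 => Dsub F d θ θs
  | n + 1 => DDchain F d θ θs n * DsSub F d θ θs * Dsub F d θ θs

/-- The `F`-subspace `e*_r D e*_{κ 1} D e*_{κ 2} ⋯ D e*_{κ m}` of `T`. -/
def esChain (F : Type*) [Field F] (d : ℕ) (θ θs : ℕ → F) (r : ℕ) (κ : ℕ → ℕ) :
    ℕ → Submodule F (TAlg F d θ θs)
  | 0 => Submodule.span F {esT F d θ θs r}
  | m + 1 => esChain F d θ θs r κ m * Dsub F d θ θs *
      Submodule.span F {esT F d θ θs (κ (m + 1))}

/-- The sequence `(c_0, c_1, …, c_m)` is convex: `c_{i−1} − c_i ≥ c_i − c_{i+1}`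
for `1 ≤ i ≤ m−1`. -/
def ConvexSeq (c : ℕ → ℤ) (m : ℕ) : Prop :=
  ∀ i, 1 ≤ i → i + 1 ≤ m → c i - c (i + 1) ≤ c (i - 1) - c i

end

universe u

open scoped TensorProduct
open Finset (range)

section Half
variable {L : Type u} [Field L] {A : Type u} [Ring A] [Algebra L A]
  {M : Type u} [Ring M] [Algebra L M]

/-- A complete system of orthogonal idempotents `e 0, …, e d` with respect to which `a` is
block tridiagonal. -/
structure IsHalf (d : ℕ) (e : ℕ → A) (a : A) : Prop where
  mul_e : ∀ i ≤ d, ∀ j ≤ d, e i * e j = if i = j then e i else 0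
  sum_e : ∑ i ∈ range (d + 1), e i = 1
  trid : ∀ i ≤ d, ∀ j ≤ d, (i + 2 ≤ j ∨ j + 2 ≤ i) → e i * a * e j = 0

/-- The element with eigenvalues `θ i` on the idempotents `e i`. -/
def eigenSum (d : ℕ) (θ : ℕ → L) (e : ℕ → A) : A := ∑ i ∈ range (d + 1), θ i • e i

/-- Idempotents `P k j` (`k ≤ s`) resolving `X + l j • N` with eigenvalues `θ j, …, θ (j + s)`,
with the triangularity that makes `Y ⊗ 1 + N' ⊗ a` block tridiagonal after tensoring with a
tridiagonal system of diameter `n` and regrouping by total degree. -/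
structure IsLadder (s n : ℕ) (θ l : ℕ → L) (X N Y N' : M) (P : ℕ → ℕ → M) : Prop where
  zero : ∀ k j, s < k → P k j = 0
  mul : ∀ j ≤ n, ∀ k k', P k j * P k' j = if k = k' then P k j else 0
  sum : ∀ j ≤ n, ∑ k ∈ range (s + 1), P k j = 1
  lin : ∀ j ≤ n, ∑ k ∈ range (s + 1), θ (j + k) • P k j = X + l j • N
  tridY : ∀ j ≤ n, ∀ k k', (k + 2 ≤ k' ∨ k' + 2 ≤ k) → P k j * Y * P k' j = 0
  tridN : ∀ j ≤ n, ∀ k k', (k + 2 ≤ k' ∨ k' + 2 ≤ k) → P k j * N' * P k' j = 0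
  tridUp : ∀ j, j + 1 ≤ n → ∀ k k', (k + 1 ≤ k' ∨ k' + 3 ≤ k) → P k j * N' * P k' (j + 1) = 0
  tridDown : ∀ j, j + 1 ≤ n → ∀ k k', (k + 1 ≤ k' ∨ k' + 3 ≤ k) →
    P k' (j + 1) * N' * P k j = 0

def shifted (P : ℕ → ℕ → M) (i j : ℕ) : M := if j ≤ i then P (i - j) j else 0

variable (L) in
/-- The idempotent of total degree `i` in the tensor product of a ladder with a system `e`. -/
def ladderSum (n : ℕ) (P : ℕ → ℕ → M) (e : ℕ → A) (i : ℕ) : M ⊗[L] A :=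
  ∑ j ∈ range (n + 1), shifted P i j ⊗ₜ[L] e j

lemma sum_shifted {s n j : ℕ} (hj : j ≤ n) {V : Type*} [AddCommMonoid V] (f : ℕ → M → V)
    (hf : ∀ i, f i 0 = 0) {P : ℕ → ℕ → M} (hP : ∀ k j, s < k → P k j = 0) :
    ∑ i ∈ range (n + s + 1), f i (shifted P i j) = ∑ k ∈ range (s + 1), f (j + k) (P k j) := by
  symm
  refine Finset.sum_bij_ne_zero (fun k _ _ => j + k) ?_ ?_ ?_ ?_
  · intro k hk _
    simp only [Finset.mem_range] at *
    omega
  · intro a _ _ b _ _ h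
    omega
  · intro i hi h
    have hji : j ≤ i := by
      by_contra hc
      exact h (by rw [shifted, if_neg hc, hf])
    refine ⟨i - j, ?_, ?_, by omega⟩
    · by_contra hc
      simp only [Finset.mem_range] at hc
      exact h (by rw [shifted, if_pos hji, hP _ _ (by omega), hf])
    · rw [shifted, if_pos hji] at h
      rwa [Nat.add_sub_cancel' hji]
  · intro k _ _
    rw [shifted, if_pos (Nat.le_add_right j k), Nat.add_sub_cancel_left]

variable {s n : ℕ} {θ l : ℕ → L} {X N Y N' : M} {P : ℕ → ℕ → M} {e : ℕ → A} {a : A}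

lemma IsLadder.lin_ladderSum (hP : IsLadder s n θ l X N Y N' P) (he : IsHalf n e a) :
    eigenSum (n + s) θ (ladderSum L n P e) = X ⊗ₜ[L] 1 + N ⊗ₜ[L] eigenSum n l e := by
  unfold eigenSum ladderSum
  simp only [Finset.smul_sum]
  rw [Finset.sum_comm, ← he.sum_e, TensorProduct.tmul_sum, TensorProduct.tmul_sum,
    ← Finset.sum_add_distrib]
  refine Finset.sum_congr rfl fun j hj => ?_
  have hj' : j ≤ n := by simpa [Nat.lt_succ_iff] using hj
  simp only [TensorProduct.smul_tmul', ← TensorProduct.sum_tmul]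
  rw [sum_shifted hj' (fun i m => θ i • m) (fun i => smul_zero _) hP.zero, hP.lin j hj',
    TensorProduct.add_tmul, TensorProduct.smul_tmul]

lemma IsLadder.shifted_mul (hP : IsLadder s n θ l X N Y N' P) {j : ℕ} (hj : j ≤ n) (i i' : ℕ) :
    shifted P i j * shifted P i' j = if i = i' then shifted P i j else 0 := by
  unfold shifted
  split_ifs with h1 h2 h3 h4 h5 <;> try simp
  · subst h3; simpa using hP.mul j hj (i - j) (i - j)
  · rw [hP.mul j hj, if_neg (by omega)]
  · omega

lemma IsLadder.shifted_tridY (hP : IsLadder s n θ l X N Y N' P) {j : ℕ} (hj : j ≤ n) (i i' : ℕ)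
    (h : i + 2 ≤ i' ∨ i' + 2 ≤ i) : shifted P i j * Y * shifted P i' j = 0 := by
  unfold shifted
  split_ifs <;> try simp
  exact hP.tridY j hj _ _ (by omega)

lemma IsLadder.shifted_tridN (hP : IsLadder s n θ l X N Y N' P) {j j' : ℕ} (hj : j ≤ n)
    (hj' : j' ≤ n) (hjj : j ≤ j' + 1 ∧ j' ≤ j + 1) (i i' : ℕ)
    (h : i + 2 ≤ i' ∨ i' + 2 ≤ i) : shifted P i j * N' * shifted P i' j' = 0 := by
  unfold shifted
  split_ifs <;> try simp
  obtain rfl | rfl | rfl : j' = j ∨ j' = j + 1 ∨ j = j' + 1 := by omega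
  · exact hP.tridN _ hj _ _ (by omega)
  · exact hP.tridUp _ hj' _ _ (by omega)
  · exact hP.tridDown _ hj _ _ (by omega)

lemma IsLadder.isHalf_ladderSum (hP : IsLadder s n θ l X N Y N' P) (he : IsHalf n e a) :
    IsHalf (n + s) (ladderSum L n P e) (Y ⊗ₜ[L] 1 + N' ⊗ₜ[L] a) where
  mul_e i _ i' _ := by
    unfold ladderSum
    rw [Finset.sum_mul_sum]
    simp only [Algebra.TensorProduct.tmul_mul_tmul]
    have key : ∀ j ∈ range (n + 1), ∑ j' ∈ range (n + 1),
        (shifted P i j * shifted P i' j') ⊗ₜ[L] (e j * e j') =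
        if i = i' then shifted P i j ⊗ₜ[L] e j else 0 := by
      intro j hj
      rw [Finset.sum_eq_single j]
      · rw [Finset.mem_range, Nat.lt_succ_iff] at hj
        rw [hP.shifted_mul hj, he.mul_e j hj j hj, if_pos rfl]
        split_ifs <;> simp
      · intro j' hj' hne
        rw [Finset.mem_range, Nat.lt_succ_iff] at hj hj'
        rw [he.mul_e j hj j' hj', if_neg (Ne.symm hne), TensorProduct.tmul_zero]
      · exact fun h => absurd hj h
    rw [Finset.sum_congr rfl key]
    split_ifs <;> simp
  sum_e := by
    unfold ladderSum
    rw [Finset.sum_comm]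
    simp only [← TensorProduct.sum_tmul]
    rw [Algebra.TensorProduct.one_def, ← he.sum_e, TensorProduct.tmul_sum]
    refine Finset.sum_congr rfl fun j hj => ?_
    have hj' : j ≤ n := by simpa [Nat.lt_succ_iff] using hj
    rw [sum_shifted hj' (fun i m => m) (fun i => rfl) hP.zero, hP.sum j hj']
  trid i _ i' _ h := by
    unfold ladderSum
    rw [Finset.sum_mul, Finset.sum_mul_sum]
    refine Finset.sum_eq_zero fun j hj => Finset.sum_eq_zero fun j' hj' => ?_
    rw [Finset.mem_range, Nat.lt_succ_iff] at hj hj'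
    rw [mul_add, add_mul]
    simp only [Algebra.TensorProduct.tmul_mul_tmul, mul_one]
    rw [he.mul_e j hj j' hj']
    by_cases hjj : j ≤ j' + 1 ∧ j' ≤ j + 1
    · rw [hP.shifted_tridN hj hj' hjj i i' h, TensorProduct.zero_tmul, add_zero]
      split_ifs with hc
      · subst hc
        rw [hP.shifted_tridY hj i i' h, TensorProduct.zero_tmul]
      · rw [TensorProduct.tmul_zero]
    · rw [if_neg (by rintro rfl; omega), he.trid j hj j' hj' (by omega)]
      simp

/-- A representation of the relations of `T` in which the corner at `es 0` acts by the scalars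
`t i - t (i + 1)`. -/
structure IsTDRep (d : ℕ) (θ θs t : ℕ → L) (e es : ℕ → A) : Prop where
  half : IsHalf d e (eigenSum d θs es)
  half' : IsHalf d es (eigenSum d θ e)
  ne_zero : es 0 ≠ 0
  corner : ∀ i ≤ d, es 0 * e i * es 0 = (t i - t (i + 1)) • es 0
  t_zero : t 0 = 1
  t_big : ∀ i, d < i → t i = 0

variable (L) in
/-- Some `L`-algebra carries a representation with corner scalars `t i - t (i + 1)`. -/
def Realizable (d : ℕ) (θ θs t : ℕ → L) : Prop :=
  ∃ (A : Type u) (_ : Ring A) (_ : Algebra L A) (e es : ℕ → A), IsTDRep d θ θs t e es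

lemma tmul_ne_zero_of_field {x : M} {y : A} (hx : x ≠ 0) (hy : y ≠ 0) : x ⊗ₜ[L] y ≠ 0 := by
  obtain ⟨f, hf⟩ : ∃ f : Module.Dual L M, f x ≠ 0 := by
    by_contra! h
    exact hx ((Module.forall_dual_apply_eq_zero_iff L x).1 h)
  intro h
  have h2 := congrArg (TensorProduct.lid L A ∘ LinearMap.rTensor A f) h
  simp [hf, hy] at h2

lemma IsLadder.realizable {θs ls t T : ℕ → L} {Ps : ℕ → ℕ → M} {w : ℕ → ℕ → L}
    (hP : IsLadder s n θ l X N Y N' P) (hPs : IsLadder s n θs ls Y N' X N Ps)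
    (h0 : Ps 0 0 ≠ 0)
    (hw : ∀ j ≤ n, ∀ k ≤ s, Ps 0 0 * P k j * Ps 0 0 = w k j • Ps 0 0)
    (hT : Realizable L n l ls T) (ht0 : t 0 = 1) (htb : ∀ i, n + s < i → t i = 0)
    (ht : ∀ i ≤ n + s, t i - t (i + 1) =
      ∑ k ∈ range (s + 1), if k ≤ i then w k (i - k) * (T (i - k) - T (i - k + 1)) else 0) :
    Realizable L (n + s) θ θs t := by
  obtain ⟨A, _, _, e, es, h⟩ := hT
  refine ⟨M ⊗[L] A, inferInstance, inferInstance, ladderSum L n P e, ladderSum L n Ps es, ?_⟩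
  have hes : ladderSum L n Ps es 0 = Ps 0 0 ⊗ₜ es 0 := by
    unfold ladderSum
    rw [Finset.sum_eq_single 0]
    · simp [shifted]
    · intro j _ hj
      rw [shifted, if_neg (by omega), TensorProduct.zero_tmul]
    · simp
  refine ⟨?_, ?_, ?_, ?_, ht0, htb⟩
  · rw [hPs.lin_ladderSum h.half']
    exact hP.isHalf_ladderSum h.half
  · rw [hP.lin_ladderSum h.half]
    exact hPs.isHalf_ladderSum h.half'
  · rw [hes]
    exact tmul_ne_zero_of_field h0 h.ne_zero
  · intro i hi
    have hw' : ∀ j ≤ n, Ps 0 0 * shifted P i j * Ps 0 0 =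
        (if j ≤ i ∧ i ≤ j + s then w (i - j) j else 0) • Ps 0 0 := by
      intro j hj
      unfold shifted
      split_ifs with h1 h2 h3
      · exact hw j hj _ (by omega)
      · rw [hP.zero _ _ (by omega)]; simp
      · omega
      · simp
    have key : ∑ j ∈ range (n + 1), (if j ≤ i ∧ i ≤ j + s then w (i - j) j else 0) *
        (T j - T (j + 1)) = t i - t (i + 1) := by
      rw [ht i hi]
      refine Finset.sum_bij_ne_zero (fun j _ _ => i - j) ?_ ?_ ?_ ?_
      · intro j _ hne
        have : j ≤ i ∧ i ≤ j + s := by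
          by_contra hc
          simp [hc] at hne
        simp only [Finset.mem_range]
        omega
      · intro a _ ha b _ hb hab
        have h1 : a ≤ i ∧ i ≤ a + s := by
          by_contra hc
          simp [hc] at ha
        have h2 : b ≤ i ∧ i ≤ b + s := by
          by_contra hc
          simp [hc] at hb
        omega
      · intro k hk hne
        have hki : k ≤ i := by
          by_contra hc
          simp [hc] at hne
        rw [Finset.mem_range] at hk
        rw [if_pos hki] at hne
        have hin : i - k ≤ n := by
          by_contra hc
          rw [h.t_big _ (by omega), h.t_big _ (by omega)] at hne
          simp at hne
        refine ⟨i - k, by simpa [Nat.lt_succ_iff] using hin, ?_, by omega⟩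
        rw [if_pos ⟨by omega, by omega⟩, Nat.sub_sub_self hki]
        exact hne
      · intro j _ hne
        have h1 : j ≤ i ∧ i ≤ j + s := by
          by_contra hc
          simp [hc] at hne
        rw [if_pos h1, if_pos (by omega), Nat.sub_sub_self h1.1]
    rw [hes, ← key, Finset.sum_smul]
    unfold ladderSum
    rw [Finset.mul_sum, Finset.sum_mul]
    refine Finset.sum_congr rfl fun j hj => ?_
    rw [Finset.mem_range, Nat.lt_succ_iff] at hj
    rw [Algebra.TensorProduct.tmul_mul_tmul, Algebra.TensorProduct.tmul_mul_tmul, hw' j hj,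
      h.corner j hj, TensorProduct.smul_tmul_smul]

end Half

section Basic
variable {L : Type u} [Field L] {d : ℕ} {θ θs t : ℕ → L}

lemma Realizable.zero (θ θs : ℕ → L) : Realizable L 0 θ θs (fun i => if i = 0 then 1 else 0) := by
  refine ⟨L, inferInstance, inferInstance, fun _ => 1, fun _ => 1, ⟨?_, by simp, ?_⟩,
    ⟨?_, by simp, ?_⟩, one_ne_zero, ?_, by simp, ?_⟩
  all_goals intros; first | omega | simp_all
  omega

lemma eigenSum_affine {A : Type u} [Ring A] [Algebra L A] {θ' : ℕ → L} {a c : L}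
    {e : ℕ → A} (he : ∑ i ∈ range (d + 1), e i = 1) (hθ : ∀ i ≤ d, θ' i = a * θ i + c) :
    eigenSum d θ' e = a • eigenSum d θ e + c • (1 : A) := by
  rw [← he, eigenSum, eigenSum, Finset.smul_sum, Finset.smul_sum, ← Finset.sum_add_distrib]
  refine Finset.sum_congr rfl fun i hi => ?_
  rw [Finset.mem_range, Nat.lt_succ_iff] at hi
  rw [hθ i hi, add_smul, mul_smul]

lemma IsHalf.affine {A : Type u} [Ring A] [Algebra L A] {e : ℕ → A} {x : A} (h : IsHalf d e x)
    (a c : L) : IsHalf d e (a • x + c • (1 : A)) where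
  mul_e := h.mul_e
  sum_e := h.sum_e
  trid i hi j hj hij := by
    rw [mul_add, add_mul, mul_smul_comm, smul_mul_assoc, h.trid i hi j hj hij, mul_smul_comm,
      mul_one, smul_mul_assoc, h.mul_e i hi j hj, if_neg (by omega)]
    simp

lemma Realizable.affine (h : Realizable L d θ θs t) {θ' θs' : ℕ → L} {a c a' c' : L}
    (hθ : ∀ i ≤ d, θ' i = a * θ i + c) (hθs : ∀ i ≤ d, θs' i = a' * θs i + c') :
    Realizable L d θ' θs' t := by
  obtain ⟨A, _, _, e, es, h⟩ := h
  refine ⟨A, inferInstance, inferInstance, e, es, ?_, ?_, h.ne_zero, h.corner, h.t_zero, h.t_big⟩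
  · rw [eigenSum_affine h.half'.sum_e hθs]
    exact h.half.affine _ _
  · rw [eigenSum_affine h.half.sum_e hθ]
    exact h.half'.affine _ _

end Basic

section OneStep
variable {L : Type u} [Field L]

lemma sub_mul_sub_of_trace_det {Z : Matrix (Fin 2) (Fin 2) L} {a b : L} (ht : Z.trace = a + b)
    (hd : Z.det = a * b) : (Z - a • 1) * (Z - b • 1) = 0 := by
  rw [Matrix.trace_fin_two] at ht
  rw [Matrix.det_fin_two] at hd
  ext i j
  fin_cases i <;> fin_cases j <;> simp [Matrix.mul_apply, Fin.sum_univ_two]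
  · linear_combination (Z 0 0) * ht - hd
  · linear_combination (Z 0 1) * ht
  · linear_combination (Z 1 0) * ht
  · linear_combination (Z 1 1) * ht - hd

lemma det_sub_of_trace_det {Z : Matrix (Fin 2) (Fin 2) L} {a b : L} (ht : Z.trace = a + b)
    (hd : Z.det = a * b) : (Z - a • 1).det = 0 := by
  rw [Matrix.trace_fin_two] at ht
  rw [Matrix.det_fin_two] at hd ⊢
  simp
  linear_combination hd - a * ht

lemma mul_adjugate_mul_of_det {Z N : Matrix (Fin 2) (Fin 2) L} {c : L} (hc : c ≠ 0)
    (hZ : Z.det = 0) (hZ' : (Z + c • N).det = 0) : Z * N.adjugate * (Z + c • N) = 0 := by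
  have h : Z 0 0 * N 1 1 + N 0 0 * Z 1 1 - Z 0 1 * N 1 0 - N 0 1 * Z 1 0
      + c * (N 0 0 * N 1 1 - N 0 1 * N 1 0) = 0 := by
    rw [Matrix.det_fin_two] at hZ hZ'
    simp at hZ'
    refine (mul_eq_zero.1 ?_).resolve_left hc
    linear_combination hZ' - hZ
  rw [Matrix.det_fin_two] at hZ
  ext i j
  fin_cases i <;> fin_cases j <;> simp [Matrix.mul_apply, Fin.sum_univ_two, Matrix.adjugate_fin_two]
  · linear_combination (Z 0 0) * h - N 0 0 * hZ
  · linear_combination (Z 0 1) * h - N 0 1 * hZ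
  · linear_combination (Z 1 0) * h - N 1 0 * hZ
  · linear_combination (Z 1 1) * h - N 1 1 * hZ

lemma mul_adjugate_mul_of_det' {Z N : Matrix (Fin 2) (Fin 2) L} {c : L} (hc : c ≠ 0)
    (hZ : Z.det = 0) (hZ' : (Z + c • N).det = 0) : (Z + c • N) * N.adjugate * Z = 0 := by
  have := mul_adjugate_mul_of_det (Z := Z + c • N) (N := N) (neg_ne_zero.2 hc) hZ'
    (by simpa using hZ)
  simpa using this

def twoProj (θ l : ℕ → L) (X N : Matrix (Fin 2) (Fin 2) L) (k j : ℕ) : Matrix (Fin 2) (Fin 2) L :=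
  if k = 0 then (θ j - θ (j + 1))⁻¹ • (X + l j • N - θ (j + 1) • 1)
  else if k = 1 then (θ (j + 1) - θ j)⁻¹ • (X + l j • N - θ j • 1) else 0

lemma isLadder_twoProj {n : ℕ} {θ l : ℕ → L} {X N : Matrix (Fin 2) (Fin 2) L}
    (Y : Matrix (Fin 2) (Fin 2) L)
    (hθ : ∀ j ≤ n, θ j ≠ θ (j + 1)) (hl : ∀ j, j + 1 ≤ n → l j ≠ l (j + 1))
    (htr : ∀ j ≤ n, (X + l j • N).trace = θ j + θ (j + 1))
    (hdet : ∀ j ≤ n, (X + l j • N).det = θ j * θ (j + 1)) :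
    IsLadder 1 n θ l X N Y N.adjugate (twoProj θ l X N) := by
  have hz : ∀ j ≤ n, twoProj θ l X N 0 j + twoProj θ l X N 1 j = 1 := by
    intro j hj
    have h1 := sub_ne_zero.2 (hθ j hj)
    have h2 : θ (j + 1) - θ j = -(θ j - θ (j + 1)) := by ring
    simp only [twoProj, if_true, one_ne_zero, if_false]
    rw [h2, inv_neg, neg_smul, ← sub_eq_add_neg, ← smul_sub, sub_sub_sub_cancel_left, ← sub_smul,
      smul_smul, inv_mul_cancel₀ h1, one_smul]
  have h01 : ∀ j ≤ n, twoProj θ l X N 0 j * twoProj θ l X N 1 j = 0 := by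
    intro j hj
    simp only [twoProj, if_true, one_ne_zero, if_false]
    rw [smul_mul_smul_comm, sub_mul_sub_of_trace_det, smul_zero]
    · rw [htr j hj, add_comm]
    · rw [hdet j hj, mul_comm]
  have h10 : ∀ j ≤ n, twoProj θ l X N 1 j * twoProj θ l X N 0 j = 0 := by
    intro j hj
    simp only [twoProj, if_true, one_ne_zero, if_false]
    rw [smul_mul_smul_comm, sub_mul_sub_of_trace_det (htr j hj) (hdet j hj), smul_zero]
  have h2 : ∀ k j, 1 < k → twoProj θ l X N k j = 0 := by
    intro k j hk
    simp only [twoProj]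
    rw [if_neg (by omega), if_neg (by omega)]
  have hdd : ∀ j, j + 1 ≤ n → (X + l j • N - θ (j + 1) • 1).det = 0 ∧
      (X + l j • N - θ (j + 1) • 1 + (l (j + 1) - l j) • N).det = 0 ∧
      X + l (j + 1) • N - θ (j + 1) • 1 =
        X + l j • N - θ (j + 1) • 1 + (l (j + 1) - l j) • N := by
    intro j hj
    have h3 : X + l (j + 1) • N - θ (j + 1) • 1 =
        X + l j • N - θ (j + 1) • 1 + (l (j + 1) - l j) • N := by
      rw [sub_smul]; abel
    refine ⟨det_sub_of_trace_det (b := θ j) ?_ ?_, ?_, h3⟩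
    · rw [htr j (by omega), add_comm]
    · rw [hdet j (by omega), mul_comm]
    · rw [← h3]
      exact det_sub_of_trace_det (htr _ hj) (hdet _ hj)
  refine ⟨h2, ?_, ?_, ?_, ?_, ?_, ?_, ?_⟩
  · intro j hj k k'
    rcases Nat.lt_or_ge 1 k with hk | hk
    · rw [h2 k j hk]; simp
    rcases Nat.lt_or_ge 1 k' with hk' | hk'
    · rw [h2 k' j hk', if_neg (by omega), mul_zero]
    have e0 : twoProj θ l X N 0 j * twoProj θ l X N 0 j = twoProj θ l X N 0 j := by
      conv_rhs => rw [← mul_one (twoProj θ l X N 0 j), ← hz j hj, mul_add, h01 j hj, add_zero]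
    have e1 : twoProj θ l X N 1 j * twoProj θ l X N 1 j = twoProj θ l X N 1 j := by
      conv_rhs => rw [← mul_one (twoProj θ l X N 1 j), ← hz j hj, mul_add, h10 j hj, zero_add]
    interval_cases k <;> interval_cases k' <;> simp [e0, e1, h01 j hj, h10 j hj]
  · intro j hj
    simpa [Finset.sum_range_succ] using hz j hj
  · intro j hj
    have h1 := sub_ne_zero.2 (hθ j hj)
    have h3 : θ (j + 1) - θ j = -(θ j - θ (j + 1)) := by ring
    simp only [Finset.sum_range_succ, Finset.sum_range_zero, zero_add, add_zero, twoProj, if_true,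
      one_ne_zero, if_false]
    rw [h3, inv_neg]
    match_scalars <;> field_simp <;> ring
  · intro j _ k k' h
    rcases Nat.lt_or_ge 1 k with hk | hk
    · rw [h2 k j hk]; simp
    · rw [h2 k' j (by omega)]; simp
  · intro j _ k k' h
    rcases Nat.lt_or_ge 1 k with hk | hk
    · rw [h2 k j hk]; simp
    · rw [h2 k' j (by omega)]; simp
  · intro j hj k k' h
    rcases Nat.lt_or_ge 1 k with hk | hk
    · rw [h2 k j hk]; simp
    rcases Nat.lt_or_ge 1 k' with hk' | hk'
    · rw [h2 k' _ hk']; simp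
    obtain ⟨rfl, rfl⟩ : k = 0 ∧ k' = 1 := by omega
    obtain ⟨a1, a2, a3⟩ := hdd j hj
    simp only [twoProj, if_true, one_ne_zero, if_false]
    rw [a3, smul_mul_assoc, smul_mul_smul_comm,
      mul_adjugate_mul_of_det (sub_ne_zero.2 (hl j hj).symm) a1 a2, smul_zero]
  · intro j hj k k' h
    rcases Nat.lt_or_ge 1 k with hk | hk
    · rw [h2 k j hk]; simp
    rcases Nat.lt_or_ge 1 k' with hk' | hk'
    · rw [h2 k' _ hk']; simp
    obtain ⟨rfl, rfl⟩ : k = 0 ∧ k' = 1 := by omega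
    obtain ⟨a1, a2, a3⟩ := hdd j hj
    simp only [twoProj, if_true, one_ne_zero, if_false]
    rw [a3, smul_mul_assoc, smul_mul_smul_comm,
      mul_adjugate_mul_of_det' (sub_ne_zero.2 (hl j hj).symm) a1 a2, smul_zero]

end OneStep

section OneStepRealizable
variable {L : Type u} [Field L]

lemma prod_consecutive_eq {n : ℕ} {θ : ℕ → L} {B κ : L} (hκ : κ * (B + 1) = 1)
    (hrec : ∀ i, i + 2 ≤ n → θ i - θ (i + 3) = B * (θ (i + 1) - θ (i + 2))) :
    ∀ j ≤ n, θ j * θ (j + 1) = θ 0 * θ 1 + (θ j + θ (j + 1) - θ 0 - θ 1) *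
      (θ 1 - κ * (θ 2 - θ 0)) + (θ j + θ (j + 1) - θ 0 - θ 1) ^ 2 * κ := by
  have h1 : ∀ j, j + 1 ≤ n → θ (j + 1) = θ 1 - κ * (θ 2 - θ 0) +
      κ * (θ j + 2 * θ (j + 1) + θ (j + 2) - 2 * θ 0 - 2 * θ 1) := by
    intro j
    induction j with
    | zero => intro _; simp; ring
    | succ j ih =>
      intro hj
      have h2 := ih (by omega)
      have h3 := hrec j (by omega)
      simp only [add_assoc, Nat.reduceAdd] at h2 h3 ⊢
      linear_combination h2 + (θ (j + 1) - θ (j + 2)) * hκ + κ * h3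
  intro j
  induction j with
  | zero => intro _; simp
  | succ j ih =>
    intro hj
    have h2 := ih (by omega)
    have h3 := h1 j (by omega)
    simp only [add_assoc, Nat.reduceAdd] at h2 h3 ⊢
    linear_combination h2 + (θ (j + 2) - θ j) * h3

/-- The weight with which the two-dimensional ladder splits the corner scalars. -/
def oneStepWeight (κ : L) (θ θs : ℕ → L) (z : L) (j : ℕ) : L :=
  (θ 0 - θ (j + 1) + z + (θ j + θ (j + 1) - θ 0 - θ 1) *
    (κ * (θs 0 - θs 2) / (θs 0 - θs 1))) / (θ j - θ (j + 1))

def oneStepTail {S : Type*} [CommRing S] (w T : ℕ → S) (i : ℕ) : S :=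
  if i = 0 then 1 else w (i - 1) * T i + (1 - w (i - 1)) * T (i - 1)

lemma realizable_oneStep [IsAlgClosed L] {n : ℕ} {θ θs T : ℕ → L} {B κ z : L}
    (hκ : κ * (B + 1) = 1)
    (hrec : ∀ i, i + 2 ≤ n → θ i - θ (i + 3) = B * (θ (i + 1) - θ (i + 2)))
    (hrecs : ∀ i, i + 2 ≤ n → θs i - θs (i + 3) = B * (θs (i + 1) - θs (i + 2)))
    (hθ : ∀ j ≤ n, θ j ≠ θ (j + 1)) (hθs : ∀ j ≤ n, θs j ≠ θs (j + 1))
    (hθ2 : ∀ j, j + 1 ≤ n → θ j ≠ θ (j + 2)) (hθs2 : ∀ j, j + 1 ≤ n → θs j ≠ θs (j + 2))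
    (hz : z ≠ 0) (hz' : z ≠ θ 1 - θ 0)
    (hT : Realizable L n (fun j => θ j + θ (j + 1)) (fun j => θs j + θs (j + 1)) T) :
    Realizable L (n + 1) θ θs (oneStepTail (oneStepWeight κ θ θs z) T) := by
  have hs : θs 0 - θs 1 ≠ 0 := sub_ne_zero.2 (hθs 0 (by omega))
  have hp : θ 0 - θ 1 ≠ 0 := sub_ne_zero.2 (hθ 0 (by omega))
  set l : ℕ → L := fun j => θ j + θ (j + 1) with hl
  set ls : ℕ → L := fun j => θs j + θs (j + 1) with hls
  set ζ : L := z * (θs 0 - θs 1) with hζ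
  have hζ0 : ζ ≠ 0 := mul_ne_zero hz hs
  set c := θ 1 - κ * (θ 2 - θ 0) with hc
  set cs := θs 1 - κ * (θs 2 - θs 0) with hcs
  obtain ⟨x, hx⟩ : ∃ x : L, ζ * (x - x ^ 2 - κ) =
      (θ 0 - c - (θ 0 - θ 1) * x) * (cs - θs 1 - (θs 0 - θs 1) * x) := by
    have hlead : -ζ - (θ 0 - θ 1) * (θs 0 - θs 1) ≠ 0 := by
      intro h
      have : (z - (θ 1 - θ 0)) * (θs 0 - θs 1) = 0 := by rw [hζ] at h; linear_combination -h
      rcases mul_eq_zero.1 this with h | h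
      · exact hz' (sub_eq_zero.1 h)
      · exact hs h
    let p : L[X] := C (-ζ - (θ 0 - θ 1) * (θs 0 - θs 1)) * X ^ 2 +
      C (ζ + (θ 0 - c) * (θs 0 - θs 1) + (θ 0 - θ 1) * (cs - θs 1)) * X +
      C (-ζ * κ - (θ 0 - c) * (cs - θs 1))
    have hdeg : p.degree = 2 := degree_quadratic hlead
    obtain ⟨x, hx⟩ := IsAlgClosed.exists_root p (by rw [hdeg]; decide)
    refine ⟨x, ?_⟩
    simp only [p, IsRoot.def, eval_add, eval_mul, eval_C, eval_pow, eval_X] at hx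
    linear_combination hx
  set N : Matrix (Fin 2) (Fin 2) L :=
    !![x, θ 0 * (1 - x) + θ 1 * x - c; (cs - θs 0 * x - θs 1 * (1 - x)) / ζ, 1 - x] with hN
  have hNdet : N.det = κ := by
    rw [hN, Matrix.det_fin_two_of]
    field_simp
    linear_combination hx
  set X : Matrix (Fin 2) (Fin 2) L := !![θ 0, 0; 1, θ 1] - l 0 • N with hX
  set Y : Matrix (Fin 2) (Fin 2) L := !![θs 0, ζ; 0, θs 1] - ls 0 • N.adjugate with hY
  have hM : ∀ j, X + l j • N = !![θ 0, 0; 1, θ 1] + (l j - l 0) • N := by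
    intro j; rw [hX, sub_smul]; abel
  have hMs : ∀ j, Y + ls j • N.adjugate = !![θs 0, ζ; 0, θs 1] + (ls j - ls 0) • N.adjugate := by
    intro j; rw [hY, sub_smul]; abel
  rw [hN, Matrix.det_fin_two_of] at hNdet
  have hP : IsLadder 1 n θ l X N Y N.adjugate (twoProj θ l X N) := by
    refine isLadder_twoProj Y hθ ?_ ?_ ?_
    · intro j hj h
      exact hθ2 j hj (by simp only [hl] at h; linear_combination h)
    · intro j hj
      rw [hM, Matrix.trace_fin_two]
      simp [hN, hl]
      ring
    · intro j hj
      rw [hM, Matrix.det_fin_two, prod_consecutive_eq hκ hrec j hj]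
      simp [hN]
      simp only [hl]
      linear_combination (θ j + θ (j + 1) - θ 0 - θ 1) ^ 2 * hNdet
  have hPs : IsLadder 1 n θs ls Y N.adjugate X N (twoProj θs ls Y N.adjugate) := by
    have hadj : N.adjugate.adjugate = N := by
      rw [Matrix.adjugate_adjugate N (by simp)]; simp
    conv => arg 8; rw [← hadj]
    refine isLadder_twoProj X hθs ?_ ?_ ?_
    · intro j hj h
      exact hθs2 j hj (by simp only [hls] at h; linear_combination h)
    · intro j hj
      rw [hMs, Matrix.trace_fin_two]
      simp [hN, hls, Matrix.adjugate_fin_two]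
      ring
    · intro j hj
      rw [hMs, Matrix.det_fin_two, prod_consecutive_eq hκ hrecs j hj]
      simp [hN, Matrix.adjugate_fin_two]
      simp only [hls]
      have hv : ζ * ((cs - θs 0 * x - θs 1 * (1 - x)) / ζ) = cs - θs 0 * x - θs 1 * (1 - x) :=
        mul_div_cancel₀ _ hζ0
      linear_combination (θs j + θs (j + 1) - θs 0 - θs 1) * hv +
        (θs j + θs (j + 1) - θs 0 - θs 1) ^ 2 * hNdet
  have h00 : twoProj θs ls Y N.adjugate 0 0 = !![1, z; 0, 0] := by
    simp only [twoProj, if_true, hMs]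
    ext i j
    fin_cases i <;> fin_cases j <;> simp [hζ] <;> field_simp
  have hcor : ∀ A : Matrix (Fin 2) (Fin 2) L, !![1, z; 0, 0] * A * !![1, z; 0, 0] =
      (A 0 0 + z * A 1 0) • !![1, z; 0, 0] := by
    intro A
    rw [Matrix.eta_fin_two A]
    rw [Matrix.mul_fin_two, Matrix.mul_fin_two]
    ext i j
    fin_cases i <;> fin_cases j <;> simp [mul_comm]
  refine hP.realizable hPs (w := fun k j => if k = 0 then oneStepWeight κ θ θs z j
    else 1 - oneStepWeight κ θ θs z j) ?_ ?_ hT ?_ ?_ ?_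
  · rw [h00]
    intro h
    simpa using congrFun (congrFun h 0) 0
  · intro j hj k hk
    have hj' := sub_ne_zero.2 (hθ j hj)
    have h0 : twoProj θ l X N 0 j 0 0 + z * twoProj θ l X N 0 j 1 0 =
        oneStepWeight κ θ θs z j := by
      simp only [twoProj, if_true, hM, oneStepWeight]
      simp [hN]
      simp only [hl, hcs, hζ]
      field_simp
      ring
    rw [h00, hcor]
    congr 1
    obtain rfl | rfl : k = 0 ∨ k = 1 := by omega
    · simpa using h0
    · have h1 := hP.sum j hj
      simp only [Finset.sum_range_succ, Finset.sum_range_zero, zero_add] at h1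
      have e0 := congrFun (congrFun h1 0) 0
      have e1 := congrFun (congrFun h1 1) 0
      simp at e0 e1
      simp only [one_ne_zero, if_false]
      linear_combination e0 + z * e1 - h0
  · simp [oneStepTail]
  · obtain ⟨A, _, _, e, es, h⟩ := hT
    intro i hi
    rw [oneStepTail, if_neg (by omega), h.t_big _ (by omega), h.t_big _ (by omega)]
    ring
  · obtain ⟨A, _, _, e, es, h⟩ := hT
    intro i hi
    rcases i with _ | i
    · simp [oneStepTail, h.t_zero]; ring
    · simp [oneStepTail, Finset.sum_range_succ]; ring

end OneStepRealizable

section TwoStep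
variable {L : Type u} [Field L]

/-- The ladder of length two with outer idempotents `p` and `r`. -/
def threeProj {M : Type u} [Ring M] (p r : ℕ → M) (k j : ℕ) : M :=
  if k = 0 then p j else if k = 1 then 1 - p j - r j else if k = 2 then r j else 0

lemma isLadder_threeProj {M : Type u} [Ring M] [Algebra L M] {n : ℕ} {θ l : ℕ → L}
    {X N Y N' : M} {p r : ℕ → M}
    (hpp : ∀ j ≤ n, p j * p j = p j) (hrr : ∀ j ≤ n, r j * r j = r j)
    (hpr : ∀ j ≤ n, p j * r j = 0) (hrp : ∀ j ≤ n, r j * p j = 0)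
    (hlin : ∀ j ≤ n, θ (j + 1) • (1 : M) + (θ j - θ (j + 1)) • p j +
      (θ (j + 2) - θ (j + 1)) • r j = X + l j • N)
    (hpYr : ∀ j ≤ n, p j * Y * r j = 0) (hrYp : ∀ j ≤ n, r j * Y * p j = 0)
    (hpNr : ∀ j ≤ n, p j * N' * r j = 0) (hrNp : ∀ j ≤ n, r j * N' * p j = 0)
    (hpN : ∀ j, j + 1 ≤ n → p j * N' * p (j + 1) = p j * N')
    (hNp : ∀ j, j + 1 ≤ n → p (j + 1) * (N' * p j) = N' * p j)
    (hrN : ∀ j, j + 1 ≤ n → r (j + 1) * N' * r j = r (j + 1) * N')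
    (hNr : ∀ j, j + 1 ≤ n → r j * (N' * r (j + 1)) = N' * r (j + 1)) :
    IsLadder 2 n θ l X N Y N' (threeProj p r) := by
  have h3 : ∀ k j, 2 < k → threeProj p r k j = 0 := by
    intro k j hk
    rw [threeProj, if_neg (by omega), if_neg (by omega), if_neg (by omega)]
  have t0 : ∀ j, threeProj p r 0 j = p j := fun j => rfl
  have t1 : ∀ j, threeProj p r 1 j = 1 - p j - r j := fun j => rfl
  have t2 : ∀ j, threeProj p r 2 j = r j := fun j => rfl
  refine ⟨h3, ?_, ?_, ?_, ?_, ?_, ?_, ?_⟩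
  · intro j hj k k'
    rcases Nat.lt_or_ge 2 k with hk | hk
    · rw [h3 k j hk]; simp
    rcases Nat.lt_or_ge 2 k' with hk' | hk'
    · rw [h3 k' j hk', if_neg (by omega), mul_zero]
    interval_cases k <;> interval_cases k' <;>
      simp [t0, t1, t2, mul_sub, sub_mul, hpp j hj, hrr j hj, hpr j hj, hrp j hj]
  · intro j hj
    simp only [Finset.sum_range_succ, Finset.sum_range_zero, zero_add, t0, t1, t2]
    abel
  · intro j hj
    rw [← hlin j hj]
    simp only [Finset.sum_range_succ, Finset.sum_range_zero, zero_add, add_zero, t0, t1, t2]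
    module
  · intro j hj k k' h
    rcases Nat.lt_or_ge 2 k with hk | hk
    · rw [h3 k j hk]; simp
    rcases Nat.lt_or_ge 2 k' with hk' | hk'
    · rw [h3 k' j hk', mul_zero]
    obtain ⟨rfl, rfl⟩ | ⟨rfl, rfl⟩ : (k = 0 ∧ k' = 2) ∨ (k = 2 ∧ k' = 0) := by omega
    · exact hpYr j hj
    · exact hrYp j hj
  · intro j hj k k' h
    rcases Nat.lt_or_ge 2 k with hk | hk
    · rw [h3 k j hk]; simp
    rcases Nat.lt_or_ge 2 k' with hk' | hk'
    · rw [h3 k' j hk', mul_zero]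
    obtain ⟨rfl, rfl⟩ | ⟨rfl, rfl⟩ : (k = 0 ∧ k' = 2) ∨ (k = 2 ∧ k' = 0) := by omega
    · exact hpNr j hj
    · exact hrNp j hj
  · intro j hj k k' h
    rcases Nat.lt_or_ge 2 k with hk | hk
    · rw [h3 k j hk]; simp
    rcases Nat.lt_or_ge 2 k' with hk' | hk'
    · rw [h3 k' _ hk', mul_zero]
    have a1 : p j * N' * r (j + 1) = 0 := by
      rw [← hpN j hj, mul_assoc, hpr _ hj, mul_zero]
    obtain ⟨rfl, rfl⟩ | ⟨rfl, rfl⟩ | ⟨rfl, rfl⟩ :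
      (k = 0 ∧ k' = 1) ∨ (k = 0 ∧ k' = 2) ∨ (k = 1 ∧ k' = 2) := by omega
    · rw [t0, t1, mul_sub, mul_sub, mul_one, hpN j hj, a1, sub_self, sub_zero]
    · exact a1
    · rw [t1, t2]
      simp only [sub_mul, one_mul]
      rw [a1, mul_assoc (r j), hNr j hj, sub_zero, sub_self]
  · intro j hj k k' h
    rcases Nat.lt_or_ge 2 k with hk | hk
    · rw [h3 k j hk]; simp
    rcases Nat.lt_or_ge 2 k' with hk' | hk'
    · rw [h3 k' _ hk']; simp
    have a1 : r (j + 1) * N' * p j = 0 := by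
      rw [← hrN j hj, mul_assoc, hrp _ (by omega), mul_zero]
    obtain ⟨rfl, rfl⟩ | ⟨rfl, rfl⟩ | ⟨rfl, rfl⟩ :
      (k = 0 ∧ k' = 1) ∨ (k = 0 ∧ k' = 2) ∨ (k = 1 ∧ k' = 2) := by omega
    · rw [t0, t1]
      simp only [sub_mul, one_mul]
      rw [a1, mul_assoc (p _), hNp j hj, sub_zero, sub_self]
    · exact a1
    · rw [t1, t2, mul_sub, mul_sub, mul_one, hrN j hj, a1, sub_zero, sub_self]

open Matrix in
lemma isLadder_of_vectors {n : ℕ} {θ : ℕ → L} {X N Y N' : Matrix (Fin 4) (Fin 4) L}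
    {c : Bool → L} {u v : Bool → L → Fin 4 → L} {ε : Bool → L}
    (hε : ∀ x, ε x * ε x = 1)
    (hθ : ∀ j ≤ n + 1, θ j + θ (j + 1) = c (decide (Even j)))
    (hne : ∀ j ≤ n + 1, θ j ≠ θ (j + 1))
    (hvu : ∀ x a, v x a ⬝ᵥ u x a = ε x * (c x - 2 * a))
    (hvu' : ∀ x a, v x a ⬝ᵥ u (!x) a = 0)
    (hlin : ∀ x a, a • (1 : Matrix (Fin 4) (Fin 4) L) + ε x • vecMulVec (u x a) (v x a) +
      ε (!x) • vecMulVec (u (!x) a) (v (!x) a) = X + a • N)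
    (hY : ∀ x a, v x a ⬝ᵥ (Y *ᵥ u (!x) a) = 0)
    (hN : ∀ x a, v x a ⬝ᵥ (N' *ᵥ u (!x) a) = 0)
    (hvN : ∀ x a, v x a ᵥ* N' = - v (!x) (c (!x) - a))
    (hNu : ∀ x a, N' *ᵥ u x a = - u (!x) (c (!x) - a)) :
    IsLadder 2 n θ (fun j => θ (j + 1)) X N Y N'
      (threeProj
        (fun j => (ε (decide (Even j)) * (θ j - θ (j + 1)))⁻¹ •
          vecMulVec (u (decide (Even j)) (θ (j + 1))) (v (decide (Even j)) (θ (j + 1))))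
        (fun j => (ε (!decide (Even j)) * (θ (j + 2) - θ (j + 1)))⁻¹ •
          vecMulVec (u (!decide (Even j)) (θ (j + 1))) (v (!decide (Even j)) (θ (j + 1))))) := by
  have hpar : ∀ j, decide (Even (j + 1)) = !decide (Even j) := by
    intro j
    by_cases h : Even j <;> simp [Nat.even_add_one, h]
  have hε0 : ∀ x, ε x ≠ 0 := fun x h => by have := hε x; simp [h] at this
  have hρ : ∀ j ≤ n, ε (decide (Even j)) * (θ j - θ (j + 1)) ≠ 0 := fun j hj =>
    mul_ne_zero (hε0 _) (sub_ne_zero.2 (hne j (by omega)))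
  have hρ' : ∀ j ≤ n, ε (!decide (Even j)) * (θ (j + 2) - θ (j + 1)) ≠ 0 := fun j hj =>
    mul_ne_zero (hε0 _) (sub_ne_zero.2 (hne (j + 1) (by omega)).symm)
  have hd : ∀ j ≤ n, v (decide (Even j)) (θ (j + 1)) ⬝ᵥ u (decide (Even j)) (θ (j + 1)) =
      ε (decide (Even j)) * (θ j - θ (j + 1)) := by
    intro j hj
    rw [hvu, ← hθ j (by omega)]; ring
  have hd' : ∀ j ≤ n, v (!decide (Even j)) (θ (j + 1)) ⬝ᵥ u (!decide (Even j)) (θ (j + 1)) =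
      ε (!decide (Even j)) * (θ (j + 2) - θ (j + 1)) := by
    intro j hj
    have := hθ (j + 1) (by omega)
    rw [hvu, ← hpar, ← this]; ring
  have hx : ∀ j ≤ n, c (!decide (Even j)) - θ (j + 1) = θ (j + 2) := by
    intro j hj
    have := hθ (j + 1) (by omega)
    rw [← hpar, ← this]; ring
  have hx' : ∀ j ≤ n, c (!decide (Even j)) - θ (j + 2) = θ (j + 1) := by
    intro j hj
    rw [← hx j hj]; ring
  have hvu2 : ∀ x a, v (!x) a ⬝ᵥ u x a = 0 := fun x a => by simpa using hvu' (!x) a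
  have hY2 : ∀ x a, v (!x) a ⬝ᵥ (Y *ᵥ u x a) = 0 := fun x a => by simpa using hY (!x) a
  have hN2 : ∀ x a, v (!x) a ⬝ᵥ (N' *ᵥ u x a) = 0 := fun x a => by simpa using hN (!x) a
  have key : ∀ (w x y z : Fin 4 → L), vecMulVec w x * vecMulVec y z = (x ⬝ᵥ y) • vecMulVec w z := by
    intro w x y z
    rw [vecMulVec_mul_vecMulVec, vecMulVec_smul]
  refine isLadder_threeProj ?_ ?_ ?_ ?_ ?_ ?_ ?_ ?_ ?_ ?_ ?_ ?_ ?_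
  · intro j hj
    rw [smul_mul_smul_comm, key, hd j hj, smul_smul, mul_assoc, inv_mul_cancel₀ (hρ j hj), mul_one]
  · intro j hj
    rw [smul_mul_smul_comm, key, hd' j hj, smul_smul, mul_assoc, inv_mul_cancel₀ (hρ' j hj),
      mul_one]
  · intro j hj
    rw [smul_mul_smul_comm, key, hvu', zero_smul, smul_zero]
  · intro j hj
    rw [smul_mul_smul_comm, key, hvu2, zero_smul, smul_zero]
  · intro j hj
    rw [← hlin (decide (Even j)), smul_smul, smul_smul]
    have e1 : (θ j - θ (j + 1)) * (ε (decide (Even j)) * (θ j - θ (j + 1)))⁻¹ =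
        ε (decide (Even j)) := by
      rw [← div_eq_mul_inv, div_eq_iff (hρ j hj), ← mul_assoc, hε, one_mul]
    have e2 : (θ (j + 2) - θ (j + 1)) * (ε (!decide (Even j)) * (θ (j + 2) - θ (j + 1)))⁻¹ =
        ε (!decide (Even j)) := by
      rw [← div_eq_mul_inv, div_eq_iff (hρ' j hj), ← mul_assoc, hε, one_mul]
    rw [e1, e2]
  · intro j hj
    rw [smul_mul_assoc, smul_mul_smul_comm, mul_assoc, mul_vecMulVec, key, hY, zero_smul, smul_zero]
  · intro j hj
    rw [smul_mul_assoc, smul_mul_smul_comm, mul_assoc, mul_vecMulVec, key, hY2, zero_smul,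
      smul_zero]
  · intro j hj
    rw [smul_mul_assoc, smul_mul_smul_comm, mul_assoc, mul_vecMulVec, key, hN, zero_smul, smul_zero]
  · intro j hj
    rw [smul_mul_assoc, smul_mul_smul_comm, mul_assoc, mul_vecMulVec, key, hN2, zero_smul,
      smul_zero]
  · intro j hj
    rw [smul_mul_assoc, smul_mul_smul_comm, vecMulVec_mul, hvN, hx j (by omega), hpar, key,
      neg_dotProduct, ← hpar, hd (j + 1) hj, vecMulVec_neg, smul_smul, mul_assoc, mul_neg,
      inv_mul_cancel₀ (hρ (j + 1) hj)]
    simp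
  · intro j hj
    rw [mul_smul_comm, smul_mul_smul_comm, mul_vecMulVec, hNu, hx j (by omega), hpar, key,
      dotProduct_neg, ← hpar, hd (j + 1) hj, neg_vecMulVec, smul_smul, mul_comm (_⁻¹) (_⁻¹),
      mul_assoc, mul_neg, inv_mul_cancel₀ (hρ (j + 1) hj)]
    simp
  · intro j hj
    have hj' : j ≤ n := by omega
    rw [smul_mul_assoc, smul_mul_smul_comm, vecMulVec_mul, hvN, hpar, Bool.not_not, key,
      neg_dotProduct, show c (!decide (Even j)) - θ (j + 1 + 1) = θ (j + 1) from hx' j hj',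
      hd' j hj', vecMulVec_neg, smul_smul, mul_assoc, mul_neg, inv_mul_cancel₀ (hρ' j hj')]
    simp
  · intro j hj
    have hj' : j ≤ n := by omega
    rw [mul_smul_comm, smul_mul_smul_comm, mul_vecMulVec, hNu, hpar, Bool.not_not, key,
      dotProduct_neg, show c (!decide (Even j)) - θ (j + 1 + 1) = θ (j + 1) from hx' j hj',
      hd' j hj', neg_vecMulVec, smul_smul, mul_comm (_⁻¹) (_⁻¹),
      mul_assoc, mul_neg, inv_mul_cancel₀ (hρ' j hj')]
    simp

end TwoStep

section TwoStepRealizable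
variable {L : Type u} [Field L]

def twoStepFrac (b s q r : L) (x : Bool) (l : L) : L :=
  bif x then (q + b - l) * (q + s + l) / ((b - 2 * l) * s)
  else (r + l) * (r + s + b - 1 - l) / ((2 * l + 1 - b) * s)

def twoStepCoeff (b s q r : L) (θ : ℕ → L) (i : ℕ) : L :=
  twoStepFrac b s q r (decide (Even (i - 1))) (θ (i - 1))

def twoStepTail {S : Type*} [CommRing S] (g T : ℕ → S) (i : ℕ) : S :=
  if i = 0 then 1 else T i + (T (i - 2) - T i) * g i

open Matrix

lemma vecMulVec_mul_mul_vecMulVec (x y : Fin 4 → L) (A : Matrix (Fin 4) (Fin 4) L) :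
    vecMulVec x y * A * vecMulVec x y = (y ⬝ᵥ (A *ᵥ x)) • vecMulVec x y := by
  rw [mul_assoc, mul_vecMulVec, vecMulVec_mul_vecMulVec, vecMulVec_smul]

def twoStepU (b : L) (x : Bool) (a : L) : Fin 4 → L :=
  bif x then ![b - a, 1, 0, 1] else ![a, 0, 0, 1]

def twoStepV (b q r : L) (x : Bool) (a : L) : Fin 4 → L :=
  bif x then ![1, 0, q, -a] else ![1, -1, r - 1, 1 - b + a]

def twoStepUs (s q r : L) (x : Bool) (a : L) : Fin 4 → L :=
  bif x then ![s - a, -1, 1, -1] else ![a + q + r, 0, -1, -1]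

def twoStepVs (s q r : L) (x : Bool) (a : L) : Fin 4 → L :=
  bif x then ![1, q - r, q, a + r] else ![1, r - q - 1, r - 1, q + s - a]

def twoStepN (q r : L) : Matrix (Fin 4) (Fin 4) L :=
  !![-1, 1, 1 - q - r, -1; 0, 1, 0, -1; 0, 0, 1, 0; 0, 0, 0, -1]

def twoStepN' (q r : L) : Matrix (Fin 4) (Fin 4) L :=
  !![-1, 1, 1 - q - r, 0; 0, 1, 0, -1; 0, 0, 1, 0; 0, 0, 0, -1]

def twoStepX (b q r : L) : Matrix (Fin 4) (Fin 4) L :=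
  !![b, 0, q * b, 0; 1, 0, q, 0; 0, 0, 0, 0; 0, 1, 1 + q - r, b - 1]

def twoStepY (s q r : L) : Matrix (Fin 4) (Fin 4) L :=
  !![s - q - r, (q + r) * (1 + q - r) + (q - r) * s, (q + r) * (1 - r) + q * s, -(q + r + s) * q;
     -1, r - q, -q, -r;
     2, -1, q + r - 1, s + q + r;
     0, -(1 + 2 * q - 2 * r), -(1 + q - r), s + q - r]

def twoStepSign (x : Bool) : L := bif x then 1 else -1

lemma twoStep_isLadder {n : ℕ} {θ : ℕ → L} {b s q r : L}
    (hb : ∀ j ≤ n + 1, θ j + θ (j + 1) = bif decide (Even j) then b else b - 1)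
    (hθ : ∀ j ≤ n + 1, θ j ≠ θ (j + 1)) :
    IsLadder 2 n θ (fun j => θ (j + 1)) (twoStepX b q r) (twoStepN q r) (twoStepY s q r)
      (twoStepN' q r) (threeProj
        (fun j => (twoStepSign (decide (Even j)) * (θ j - θ (j + 1)))⁻¹ •
          vecMulVec (twoStepU b (decide (Even j)) (θ (j + 1)))
            (twoStepV b q r (decide (Even j)) (θ (j + 1))))
        (fun j => (twoStepSign (!decide (Even j)) * (θ (j + 2) - θ (j + 1)))⁻¹ •
          vecMulVec (twoStepU b (!decide (Even j)) (θ (j + 1)))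
            (twoStepV b q r (!decide (Even j)) (θ (j + 1))))) := by
  refine isLadder_of_vectors (c := fun x => bif x then b else b - 1) ?_ hb hθ ?_ ?_ ?_ ?_ ?_ ?_ ?_
  · rintro (_ | _) <;> simp [twoStepSign]
  · rintro (_ | _) a <;> simp [twoStepU, twoStepV, twoStepSign, dotProduct, Fin.sum_univ_four] <;>
      ring
  · rintro (_ | _) a <;> simp [twoStepU, twoStepV, dotProduct, Fin.sum_univ_four] <;> ring
  · rintro (_ | _) a <;> ext i j <;> fin_cases i <;> fin_cases j <;>
      simp [twoStepU, twoStepV, twoStepSign, twoStepX, twoStepN] <;> ring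
  · rintro (_ | _) a <;>
      simp [twoStepU, twoStepV, twoStepY, dotProduct, mulVec, Fin.sum_univ_four] <;> ring
  · rintro (_ | _) a <;>
      simp [twoStepU, twoStepV, twoStepN', dotProduct, mulVec, Fin.sum_univ_four] <;> ring
  · rintro (_ | _) a <;> ext i <;> fin_cases i <;>
      simp [twoStepV, twoStepN', dotProduct, vecMul, Fin.sum_univ_four] <;> ring
  · rintro (_ | _) a <;> ext i <;> fin_cases i <;>
      simp [twoStepU, twoStepN', dotProduct, mulVec, Fin.sum_univ_four] <;> ring

lemma twoStep_isLadder_dual {n : ℕ} {θ : ℕ → L} {b s q r : L}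
    (hb : ∀ j ≤ n + 1, θ j + θ (j + 1) = bif decide (Even j) then s else s - 1)
    (hθ : ∀ j ≤ n + 1, θ j ≠ θ (j + 1)) :
    IsLadder 2 n θ (fun j => θ (j + 1)) (twoStepY s q r) (twoStepN' q r) (twoStepX b q r)
      (twoStepN q r) (threeProj
        (fun j => (twoStepSign (decide (Even j)) * (θ j - θ (j + 1)))⁻¹ •
          vecMulVec (twoStepUs s q r (decide (Even j)) (θ (j + 1)))
            (twoStepVs s q r (decide (Even j)) (θ (j + 1))))
        (fun j => (twoStepSign (!decide (Even j)) * (θ (j + 2) - θ (j + 1)))⁻¹ •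
          vecMulVec (twoStepUs s q r (!decide (Even j)) (θ (j + 1)))
            (twoStepVs s q r (!decide (Even j)) (θ (j + 1))))) := by
  refine isLadder_of_vectors (c := fun x => bif x then s else s - 1) ?_ hb hθ ?_ ?_ ?_ ?_ ?_ ?_ ?_
  · rintro (_ | _) <;> simp [twoStepSign]
  · rintro (_ | _) a <;>
      simp [twoStepUs, twoStepVs, twoStepSign, dotProduct, Fin.sum_univ_four] <;> ring
  · rintro (_ | _) a <;> simp [twoStepUs, twoStepVs, dotProduct, Fin.sum_univ_four] <;> ring
  · rintro (_ | _) a <;> ext i j <;> fin_cases i <;> fin_cases j <;>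
      simp [twoStepUs, twoStepVs, twoStepSign, twoStepY, twoStepN'] <;> ring
  · rintro (_ | _) a <;>
      simp [twoStepUs, twoStepVs, twoStepX, dotProduct, mulVec, Fin.sum_univ_four] <;> ring
  · rintro (_ | _) a <;>
      simp [twoStepUs, twoStepVs, twoStepN, dotProduct, mulVec, Fin.sum_univ_four] <;> ring
  · rintro (_ | _) a <;> ext i <;> fin_cases i <;>
      simp [twoStepVs, twoStepN, dotProduct, vecMul, Fin.sum_univ_four] <;> ring
  · rintro (_ | _) a <;> ext i <;> fin_cases i <;>
      simp [twoStepUs, twoStepN, dotProduct, mulVec, Fin.sum_univ_four] <;> ring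

lemma twoStep_weight_zero {b s q r a : L} {x : Bool} (hs : s ≠ 0)
    (h : (bif x then b else b - 1) - 2 * a ≠ 0) :
    (![1, q - r, q, r] ⬝ᵥ twoStepU b x ((bif x then b else b - 1) - a)) *
      (twoStepV b q r x ((bif x then b else b - 1) - a) ⬝ᵥ ![s, -1, 1, -1]) /
      (twoStepSign x * (a - ((bif x then b else b - 1) - a)) * s) =
    1 - twoStepFrac b s q r x a := by
  have h' : twoStepSign x * (a - ((bif x then b else b - 1) - a)) * s ≠ 0 := by
    refine mul_ne_zero (mul_ne_zero ?_ fun h2 => h (by linear_combination -h2)) hs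
    cases x <;> simp [twoStepSign]
  rw [div_eq_iff h']
  cases x <;> simp only [twoStepFrac, twoStepU, twoStepV, twoStepSign, cond_true, cond_false,
    dotProduct, Fin.sum_univ_four] at h ⊢
  · obtain ⟨D, rfl⟩ : ∃ D, b = 2 * a + 1 - D := ⟨2 * a + 1 - b, by ring⟩
    have hD : D ≠ 0 := fun h2 => h (by linear_combination -h2)
    rw [show 2 * a + 1 - (2 * a + 1 - D) = D by ring]
    simp
    field_simp
    ring
  · obtain ⟨D, rfl⟩ : ∃ D, b = 2 * a + D := ⟨b - 2 * a, by ring⟩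
    rw [add_sub_cancel_left] at h ⊢
    simp
    field_simp
    ring

lemma twoStep_weight_two {b s q r a : L} {x : Bool} (hs : s ≠ 0)
    (h : (bif x then b else b - 1) - 2 * a ≠ 0) :
    (![1, q - r, q, r] ⬝ᵥ twoStepU b x a) * (twoStepV b q r x a ⬝ᵥ ![s, -1, 1, -1]) /
      (twoStepSign x * ((bif x then b else b - 1) - a - a) * s) =
    twoStepFrac b s q r x a := by
  have h' : twoStepSign x * ((bif x then b else b - 1) - a - a) * s ≠ 0 := by
    refine mul_ne_zero (mul_ne_zero ?_ fun h2 => h (by linear_combination h2)) hs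
    cases x <;> simp [twoStepSign]
  rw [div_eq_iff h']
  cases x <;> simp only [twoStepFrac, twoStepU, twoStepV, twoStepSign, cond_true, cond_false,
    dotProduct, Fin.sum_univ_four] at h ⊢
  · obtain ⟨D, rfl⟩ : ∃ D, b = 2 * a + 1 - D := ⟨2 * a + 1 - b, by ring⟩
    have hD : D ≠ 0 := fun h2 => h (by linear_combination -h2)
    rw [show 2 * a + 1 - (2 * a + 1 - D) = D by ring]
    simp
    field_simp
    ring
  · obtain ⟨D, rfl⟩ : ∃ D, b = 2 * a + D := ⟨b - 2 * a, by ring⟩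
    rw [add_sub_cancel_left] at h ⊢
    simp
    field_simp
    ring

lemma realizable_twoStep {n : ℕ} {θ θs T : ℕ → L} {b s q r : L}
    (hb : ∀ j ≤ n + 1, θ j + θ (j + 1) = bif decide (Even j) then b else b - 1)
    (hs : ∀ j ≤ n + 1, θs j + θs (j + 1) = bif decide (Even j) then s else s - 1)
    (h1 : θs 1 = 0)
    (hθ : ∀ j ≤ n + 1, θ j ≠ θ (j + 1)) (hθs : ∀ j ≤ n + 1, θs j ≠ θs (j + 1))
    (hT : Realizable L n (fun j => θ (j + 1)) (fun j => θs (j + 1)) T) :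
    Realizable L (n + 2) θ θs (twoStepTail (twoStepCoeff b s q r θ) T) := by
  have hθs0 : θs 0 = s := by simpa [h1] using hs 0 (by omega)
  have hs0 : s ≠ 0 := by have := hθs 0 (by omega); rwa [hθs0, h1] at this
  set g := twoStepCoeff b s q r θ with hg
  have hP := twoStep_isLadder (q := q) (r := r) (s := s) hb hθ
  have hPs := twoStep_isLadder_dual (q := q) (r := r) (b := b) hs hθs
  set P := threeProj (fun j => (twoStepSign (decide (Even j)) * (θ j - θ (j + 1)))⁻¹ •
          vecMulVec (twoStepU b (decide (Even j)) (θ (j + 1)))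
            (twoStepV b q r (decide (Even j)) (θ (j + 1))))
        (fun j => (twoStepSign (!decide (Even j)) * (θ (j + 2) - θ (j + 1)))⁻¹ •
          vecMulVec (twoStepU b (!decide (Even j)) (θ (j + 1)))
            (twoStepV b q r (!decide (Even j)) (θ (j + 1)))) with hPdef
  set Ps := threeProj (fun j => (twoStepSign (decide (Even j)) * (θs j - θs (j + 1)))⁻¹ •
          vecMulVec (twoStepUs s q r (decide (Even j)) (θs (j + 1)))
            (twoStepVs s q r (decide (Even j)) (θs (j + 1))))
        (fun j => (twoStepSign (!decide (Even j)) * (θs (j + 2) - θs (j + 1)))⁻¹ •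
          vecMulVec (twoStepUs s q r (!decide (Even j)) (θs (j + 1)))
            (twoStepVs s q r (!decide (Even j)) (θs (j + 1)))) with hPsdef
  have h00 : Ps 0 0 = s⁻¹ • vecMulVec ![s, -1, 1, -1] ![1, q - r, q, r] := by
    simp [hPsdef, threeProj, twoStepUs, twoStepVs, twoStepSign, hθs0, h1]
  have hcor : ∀ A, Ps 0 0 * A * Ps 0 0 =
      (s⁻¹ * (![1, q - r, q, r] ⬝ᵥ (A *ᵥ ![s, -1, 1, -1]))) • Ps 0 0 := by
    intro A
    rw [h00, smul_mul_assoc, smul_mul_smul_comm, vecMulVec_mul_mul_vecMulVec, smul_smul, smul_smul]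
    congr 1
    ring
  have hcor' : ∀ (u v : Fin 4 → L) (ρ : L), Ps 0 0 * (ρ⁻¹ • vecMulVec u v) * Ps 0 0 =
      (((![1, q - r, q, r] ⬝ᵥ u) * (v ⬝ᵥ ![s, -1, 1, -1])) / (ρ * s)) • Ps 0 0 := by
    intro u v ρ
    rw [hcor, smul_mulVec, vecMulVec_mulVec, dotProduct_smul]
    congr 1
    simp
    field_simp
  have hw0 : ∀ j ≤ n, Ps 0 0 * P 0 j * Ps 0 0 = (1 - g (j + 1)) • Ps 0 0 := by
    intro j hj
    have e := hb j (by omega)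
    have ne := sub_ne_zero.2 (hθ j (by omega))
    rw [show P 0 j = (twoStepSign (decide (Even j)) * (θ j - θ (j + 1)))⁻¹ •
          vecMulVec (twoStepU b (decide (Even j)) (θ (j + 1)))
            (twoStepV b q r (decide (Even j)) (θ (j + 1))) from rfl, hcor']
    congr 1
    rw [hg, twoStepCoeff, Nat.add_sub_cancel]
    generalize decide (Even j) = x at *
    rw [← eq_sub_iff_add_eq'] at e
    rw [e] at ne ⊢
    exact twoStep_weight_zero hs0 fun h => ne (by linear_combination -h)
  have hw2 : ∀ j ≤ n, Ps 0 0 * P 2 j * Ps 0 0 = g (j + 2) • Ps 0 0 := by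
    intro j hj
    have e := hb (j + 1) (by omega)
    have ne := sub_ne_zero.2 (hθ (j + 1) (by omega)).symm
    have hpar : decide (Even (j + 1)) = !decide (Even j) := by
      by_cases h : Even j <;> simp [Nat.even_add_one, h]
    rw [show P 2 j = (twoStepSign (!decide (Even j)) * (θ (j + 2) - θ (j + 1)))⁻¹ •
          vecMulVec (twoStepU b (!decide (Even j)) (θ (j + 1)))
            (twoStepV b q r (!decide (Even j)) (θ (j + 1))) from rfl, hcor']
    congr 1
    rw [hg, twoStepCoeff, show j + 2 - 1 = j + 1 from rfl, hpar]
    rw [hpar] at e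
    generalize (!decide (Even j)) = x at *
    rw [← eq_sub_iff_add_eq'] at e
    change θ (j + 2) = _ at e
    change θ (j + 2) - _ ≠ 0 at ne
    rw [e] at ne ⊢
    exact twoStep_weight_two hs0 fun h => ne (by linear_combination h)
  refine hP.realizable hPs (w := fun k j => if k = 0 then 1 - g (j + 1) else
    if k = 1 then g (j + 1) - g (j + 2) else g (j + 2)) ?_ ?_ hT ?_ ?_ ?_
  · rw [h00]
    intro h
    have := congrFun (congrFun h 1) 0
    simp at this
    exact hs0 this
  · intro j hj k hk
    obtain rfl | rfl | rfl : k = 0 ∨ k = 1 ∨ k = 2 := by omega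
    · exact hw0 j hj
    · have h1 := hP.sum j hj
      simp only [Finset.sum_range_succ, Finset.sum_range_zero, zero_add] at h1
      have e1 : P 1 j = 1 - P 0 j - P 2 j := by rw [← h1]; abel
      rw [e1, mul_sub, mul_sub, mul_one, sub_mul, sub_mul, hw0 j hj, hw2 j hj,
        hPs.mul 0 (by omega) 0 0]
      simp only [one_ne_zero, if_false, if_true]
      module
    · exact hw2 j hj
  · simp [twoStepTail]
  · obtain ⟨A, _, _, e, es, h⟩ := hT
    intro i hi
    rw [twoStepTail, if_neg (by omega), h.t_big _ (by omega), h.t_big _ (by omega)]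
    ring
  · obtain ⟨A, _, _, e, es, h⟩ := hT
    intro i hi
    rcases i with _ | _ | i
    · simp [twoStepTail, h.t_zero]; ring
    · simp [twoStepTail, Finset.sum_range_succ, h.t_zero]; ring
    · simp [twoStepTail, Finset.sum_range_succ]; ring

end TwoStepRealizable

section Independence
variable {F : Type u} [Field F]

lemma algebraicIndependent_of_mem_adjoin {S : Type u} [CommRing S] [IsDomain S] [Algebra F S]
    {ι : Type} [Finite ι] {T V : ι → S} (hT : AlgebraicIndependent F T)
    (hVT : ∀ i, V i ∈ Algebra.adjoin F (Set.range T))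
    (hTV : ∀ i, T i ∈ Algebra.adjoin F (Set.range V)) : AlgebraicIndependent F V := by
  set A := Algebra.adjoin F (Set.range T)
  let V' : ι → A := fun i => ⟨V i, hVT i⟩
  let T' : ι → A := fun i => ⟨T i, Algebra.subset_adjoin ⟨i, rfl⟩⟩
  have hT' : AlgebraicIndependent F T' := hT.of_comp A.val
  have htop : Algebra.adjoin F (Set.range V') = ⊤ := by
    have himg : (Algebra.adjoin F (Set.range V')).map A.val = Algebra.adjoin F (Set.range V) := by
      rw [AlgHom.map_adjoin, ← Set.range_comp]
      rfl
    rw [eq_top_iff]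
    rintro ⟨y, hy⟩ -
    have hle : A ≤ Algebra.adjoin F (Set.range V) :=
      Algebra.adjoin_le (by rintro _ ⟨i, rfl⟩; exact hTV i)
    have := hle hy
    rw [← himg] at this
    obtain ⟨z, hz, hzy⟩ := this
    have : z = ⟨y, hy⟩ := Subtype.ext hzy
    rwa [← this]
  have : Algebra.IsAlgebraic (Algebra.adjoin F (Set.range V')) A := by
    refine ⟨fun y => ?_⟩
    have hy : y ∈ Algebra.adjoin F (Set.range V') := by rw [htop]; trivial
    exact isAlgebraic_algebraMap (⟨y, hy⟩ : Algebra.adjoin F (Set.range V'))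
  have hV' := Algebra.IsAlgebraic.isTranscendenceBasis_of_lift_le_trdeg_of_finite F V'
    hT'.lift_cardinalMk_le_trdeg
  exact hV'.1.map' (f := A.val) Subtype.val_injective

lemma AlgebraicIndependent.option_of_specialize {R S : Type u} [CommRing R] [IsDomain R]
    [Algebra F R] [CommRing S] [Algebra F S] (ψ : R →ₐ[F] S) {ι : Type} {x : ι → R} {a : R}
    (hx : AlgebraicIndependent F (ψ ∘ x)) (ha : ψ a = 0) (ha0 : a ≠ 0) :
    AlgebraicIndependent F (fun o : Option ι => o.elim a x) := by
  have hx' : AlgebraicIndependent F x := hx.of_comp ψ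
  rw [hx'.option_iff_transcendental]
  intro hal
  obtain ⟨p, hp0, hp⟩ := hal.exists_nonzero_coeff_and_aeval_eq_zero
    (mem_nonZeroDivisors_of_ne_zero ha0)
  apply hp0
  obtain ⟨P, hP⟩ : ∃ P : MvPolynomial ι F, MvPolynomial.aeval x P = (p.coeff 0 : R) := by
    have h := (Algebra.adjoin_range_eq_range_aeval F x).le (p.coeff 0).2
    exact h
  have h0 : ψ (p.coeff 0 : R) = 0 := by
    rw [← p.divX_mul_X_add] at hp
    simp only [map_add, map_mul, aeval_X, aeval_C] at hp
    have h2 := congrArg ψ hp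
    rw [map_add, map_mul, ha, mul_zero, zero_add, map_zero] at h2
    exact h2
  rw [← hP, MvPolynomial.comp_aeval_apply] at h0
  have hP0 : P = 0 := hx.eq_zero_of_aeval_eq_zero P h0
  rw [hP0, map_zero] at hP
  exact Subtype.ext hP.symm

lemma AlgebraicIndependent.of_specialize {R S : Type u} [CommRing R] [IsDomain R]
    [Algebra F R] [CommRing S] [Algebra F S] (ψ : R →ₐ[F] S) {n : ℕ} (i : Fin (n + 1))
    {x : Fin (n + 1) → R}
    (hx : AlgebraicIndependent F (fun j => ψ (x (i.succAbove j)))) (h : ψ (x i) = 0)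
    (h0 : x i ≠ 0) : AlgebraicIndependent F x := by
  have := AlgebraicIndependent.option_of_specialize ψ (x := x ∘ i.succAbove) hx h h0
  refine (algebraicIndependent_equiv' (finSuccEquiv' i) ?_).2 this
  ext j
  rcases eq_or_ne j i with rfl | hj
  · simp
  · obtain ⟨k, rfl⟩ := Fin.exists_succAbove_eq hj
    simp

end Independence

section Generic
variable {F : Type u} [Field F]

variable (F) in
/-- There is a family of `d` algebraically independent corner parameters which is realizable after
embedding it in any algebraically closed field. -/
def Generic (d : ℕ) (θ θs : ℕ → F) : Prop :=
  ∃ (S : Type u) (_ : CommRing S) (_ : IsDomain S) (_ : Algebra F S) (t : ℕ → S),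
    t 0 = 1 ∧ (∀ i, d < i → t i = 0) ∧ AlgebraicIndependent F (fun i : Fin d => t (i + 1)) ∧
    ∀ (L : Type u) (_ : Field L) (_ : Algebra F L) (_ : IsAlgClosed L) (φ : S →ₐ[F] L),
      Function.Injective φ → Realizable L d (fun i => algebraMap F L (θ i))
        (fun i => algebraMap F L (θs i)) (fun i => φ (t i))

lemma Generic.zero (θ θs : ℕ → F) : Generic F 0 θ θs := by
  refine ⟨F, inferInstance, inferInstance, inferInstance, fun i => if i = 0 then 1 else 0, by simp,
    fun i hi => by simp [hi.ne'], ?_, ?_⟩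
  · rw [algebraicIndependent_empty_type_iff]
    exact Function.injective_id
  · intro L _ _ _ φ _
    have := Realizable.zero (fun i => algebraMap F L (θ i)) (fun i => algebraMap F L (θs i))
    convert this using 2 with i
    split_ifs with hi <;> simp [hi]

lemma Generic.affine {d : ℕ} {θ θs θ' θs' : ℕ → F} {a c a' c' : F} (h : Generic F d θ θs)
    (hθ : ∀ i ≤ d, θ' i = a * θ i + c) (hθs : ∀ i ≤ d, θs' i = a' * θs i + c') :
    Generic F d θ' θs' := by
  obtain ⟨S, _, _, _, t, h0, hb, hind, h⟩ := h
  refine ⟨S, inferInstance, inferInstance, inferInstance, t, h0, hb, hind, ?_⟩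
  intro L _ _ _ φ hφ
  exact (h L inferInstance inferInstance inferInstance φ hφ).affine (a := algebraMap F L a) (c := algebraMap F L c)
    (a' := algebraMap F L a') (c' := algebraMap F L c')
    (fun i hi => by rw [hθ i hi]; simp) (fun i hi => by rw [hθs i hi]; simp)

lemma Generic.oneStep {n : ℕ} {θ θs : ℕ → F} {B κ : F} (z₀ : F) (hκ : κ * (B + 1) = 1)
    (hrec : ∀ i, i + 2 ≤ n → θ i - θ (i + 3) = B * (θ (i + 1) - θ (i + 2)))
    (hrecs : ∀ i, i + 2 ≤ n → θs i - θs (i + 3) = B * (θs (i + 1) - θs (i + 2)))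
    (hθ : ∀ j ≤ n, θ j ≠ θ (j + 1)) (hθs : ∀ j ≤ n, θs j ≠ θs (j + 1))
    (hθ2 : ∀ j, j + 1 ≤ n → θ j ≠ θ (j + 2)) (hθs2 : ∀ j, j + 1 ≤ n → θs j ≠ θs (j + 2))
    (hz : oneStepWeight κ θ θs z₀ n = 1) (hw : ∀ i < n, oneStepWeight κ θ θs z₀ i ≠ 0)
    (hT : Generic F n (fun j => θ j + θ (j + 1)) (fun j => θs j + θs (j + 1))) :
    Generic F (n + 1) θ θs := by
  obtain ⟨S, _, _, _, T, h0, hb, hind, h⟩ := hT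
  set w : ℕ → S[X] := fun j => algebraMap F S[X] (oneStepWeight κ θ θs 0 j) +
    (θ j - θ (j + 1))⁻¹ • X with hwdef
  have heval : ∀ {A : Type u} [CommRing A] [Algebra F A] (φ : S[X] →ₐ[F] A) (z : F),
      φ X = algebraMap F A z → ∀ j, φ (w j) = algebraMap F A (oneStepWeight κ θ θs z j) := by
    intro A _ _ φ z hz j
    simp only [hwdef, map_add, map_smul, AlgHom.commutes, hz]
    rw [Algebra.smul_def, ← map_mul, ← map_add]
    congr 1
    simp only [oneStepWeight]
    ring
  have hβ : ∀ j z, oneStepWeight κ θ θs (z + 1) j - oneStepWeight κ θ θs z j =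
      (θ j - θ (j + 1))⁻¹ := by
    intro j z
    simp only [oneStepWeight]
    ring
  let ev : F → S[X] →ₐ[F] S := fun z =>
    (Polynomial.aeval (algebraMap F S z) : S[X] →ₐ[S] S).restrictScalars F
  have evX : ∀ z, ev z X = algebraMap F S z := fun z => aeval_X _
  have evC : ∀ z y, ev z (C y) = y := fun z y => aeval_C _ _
  refine ⟨S[X], inferInstance, inferInstance, inferInstance,
    oneStepTail w (fun i => C (T i)), by simp [oneStepTail], ?_, ?_, ?_⟩
  · intro i hi
    rw [oneStepTail, if_neg (by omega), hb _ (by omega), hb _ (by omega)]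
    simp
  · have hVev : ∀ z i, ev z (oneStepTail w (fun i => C (T i)) (i + 1)) =
        algebraMap F S (oneStepWeight κ θ θs z i) * T (i + 1) +
          (1 - algebraMap F S (oneStepWeight κ θ θs z i)) * T i := by
      intro z i
      simp only [oneStepTail, Nat.add_sub_cancel, if_neg (Nat.succ_ne_zero i), map_add, map_mul,
        map_sub, map_one, evC, heval _ _ (evX z)]
    refine AlgebraicIndependent.of_specialize (ev z₀) (Fin.last n) ?_ ?_ ?_
    · refine algebraicIndependent_of_mem_adjoin hind ?_ ?_
      · have hmem : ∀ i ≤ n, T i ∈ Algebra.adjoin F (Set.range fun i : Fin n => T (i + 1)) := by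
          intro i hi
          rcases i with _ | i
          · rw [h0]; exact one_mem _
          · exact Algebra.subset_adjoin ⟨⟨i, hi⟩, rfl⟩
        intro i
        simp only [Fin.succAbove_last, Fin.val_castSucc, hVev]
        exact add_mem (mul_mem (algebraMap_mem _ _) (hmem _ i.2))
          (mul_mem (sub_mem (one_mem _) (algebraMap_mem _ _)) (hmem _ i.2.le))
      · set V : Fin n → S := fun j => ev z₀ (oneStepTail w (fun i => C (T i))
          ((Fin.last n).succAbove j + 1)) with hV
        have hmem : ∀ i ≤ n, T i ∈ Algebra.adjoin F (Set.range V) := by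
          intro i
          induction i with
          | zero => intro _; rw [h0]; exact one_mem _
          | succ i ih =>
            intro hi
            have h1 := ih (by omega)
            have h2 : V ⟨i, hi⟩ ∈ Algebra.adjoin F (Set.range V) :=
              Algebra.subset_adjoin ⟨_, rfl⟩
            have h3 : T (i + 1) = algebraMap F S (oneStepWeight κ θ θs z₀ i)⁻¹ *
                (V ⟨i, hi⟩ - (1 - algebraMap F S (oneStepWeight κ θ θs z₀ i)) * T i) := by
              simp only [hV, Fin.succAbove_last, Fin.val_castSucc, hVev]
              rw [add_sub_cancel_right, ← mul_assoc, ← map_mul, inv_mul_cancel₀ (hw i hi), map_one,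
                one_mul]
            rw [h3]
            exact mul_mem (algebraMap_mem _ _) (sub_mem h2
              (mul_mem (sub_mem (one_mem _) (algebraMap_mem _ _)) h1))
        exact fun i => hmem _ i.2
    · simp only [Fin.val_last, hVev, hz, hb (n + 1) (by omega)]
      simp
    · intro hV
      have h1 := congrArg (ev (z₀ + 1)) hV
      simp only [Fin.val_last, hVev, map_zero, hb (n + 1) (by omega), mul_zero, zero_add] at h1
      have hTn : T n ≠ 0 := by
        rcases n with _ | n
        · rw [h0]; exact one_ne_zero
        · exact hind.ne_zero (Fin.last n)
      have h2 := hβ n z₀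
      rw [hz] at h2
      rw [eq_add_of_sub_eq h2, map_add, map_one] at h1
      have h3 : algebraMap F S (θ n - θ (n + 1))⁻¹ ≠ 0 := by
        rw [Ne, FaithfulSMul.algebraMap_eq_zero_iff]
        exact inv_ne_zero (sub_ne_zero.2 (hθ n le_rfl))
      apply mul_ne_zero h3 hTn
      linear_combination -h1
  · intro L _ _ _ φ hφ
    have hC : Function.Injective (φ.comp (Polynomial.CAlgHom (R := F) (A := S))) :=
      hφ.comp C_injective
    have hinj : Function.Injective (algebraMap F L) := (algebraMap F L).injective
    have hR := realizable_oneStep (θ := fun i => algebraMap F L (θ i))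
      (θs := fun i => algebraMap F L (θs i)) (z := φ X) (κ := algebraMap F L κ)
      (B := algebraMap F L B) (n := n) (T := fun i => φ (C (T i)))
      (by rw [← map_one (algebraMap F L), ← map_add, ← map_mul, hκ])
      (fun i hi => by simp only [← map_sub, ← map_mul, hrec i hi])
      (fun i hi => by simp only [← map_sub, ← map_mul, hrecs i hi])
      (fun j hj => hinj.ne (hθ j hj)) (fun j hj => hinj.ne (hθs j hj))
      (fun j hj => hinj.ne (hθ2 j hj)) (fun j hj => hinj.ne (hθs2 j hj))
      ?_ ?_ ?_
    · convert hR using 2 with i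
      have hwi : ∀ j, φ (w j) = oneStepWeight (algebraMap F L κ) (fun i => algebraMap F L (θ i))
          (fun i => algebraMap F L (θs i)) (φ X) j := by
        intro j
        have h1 : algebraMap F L (oneStepWeight κ θ θs 0 j) =
            oneStepWeight (algebraMap F L κ) (fun i => algebraMap F L (θ i))
              (fun i => algebraMap F L (θs i)) 0 j := by
          simp [oneStepWeight]
        simp only [hwdef, map_add, map_smul, AlgHom.commutes, h1]
        simp only [Algebra.smul_def, oneStepWeight, map_inv₀, map_sub]
        ring
      unfold oneStepTail
      split_ifs
      · simp
      · simp [hwi]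
    · rw [Ne, map_eq_zero_iff φ hφ]
      exact X_ne_zero
    · intro hX
      rw [← map_sub, ← φ.commutes] at hX
      exact X_ne_C _ (hφ hX)
    · simp only [← map_add]
      exact h L inferInstance inferInstance inferInstance _ hC

end Generic

section GenericTwoStep
variable {F : Type u} [Field F]

def twoStepPoly {R : Type*} [CommRing R] [Algebra F R] (b s : F) (q r : R) (x : Bool) (l : F) : R :=
  bif x then (q + algebraMap F R (b - l)) * (q + algebraMap F R (s + l)) *
    algebraMap F R ((b - 2 * l) * s)⁻¹
  else (r + algebraMap F R l) * (r + algebraMap F R (s + b - 1 - l)) *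
    algebraMap F R ((2 * l + 1 - b) * s)⁻¹

lemma map_twoStepPoly {R R' : Type*} [CommRing R] [Algebra F R] [CommRing R'] [Algebra F R']
    (φ : R →ₐ[F] R') (b s : F) (q r : R) (x : Bool) (l : F) :
    φ (twoStepPoly b s q r x l) = twoStepPoly b s (φ q) (φ r) x l := by
  cases x <;> simp only [twoStepPoly, cond_true, cond_false, map_mul, map_add, AlgHom.commutes]

lemma twoStepPoly_eq_twoStepFrac {K : Type u} [Field K] [Algebra F K] (b s : F) (q r : K)
    (x : Bool) (l : F) : twoStepPoly b s q r x l =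
      twoStepFrac (algebraMap F K b) (algebraMap F K s) q r x (algebraMap F K l) := by
  cases x <;> simp only [twoStepPoly, twoStepFrac, cond_true, cond_false, map_sub, map_add,
    map_mul, map_inv₀, map_one, map_ofNat, div_eq_mul_inv] <;> ring

lemma twoStepPoly_algebraMap {R : Type*} [CommRing R] [Algebra F R] (b s q r : F)
    (x : Bool) (l : F) : twoStepPoly b s (algebraMap F R q) (algebraMap F R r) x l =
      algebraMap F R (twoStepFrac b s q r x l) := by
  cases x <;> simp only [twoStepPoly, twoStepFrac, cond_true, cond_false, div_eq_mul_inv,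
    ← map_add, ← map_mul] <;> congr 1 <;> ring

lemma twoStepPoly_ne_zero {R : Type*} [CommRing R] [IsDomain R] [Algebra F R] {b s : F} {q r : R}
    {x : Bool} {l : F} (hs : s ≠ 0) (hq : ∀ c, (bif x then q else r) + algebraMap F R c ≠ 0)
    (hl : (bif x then b else b - 1) ≠ 2 * l) : twoStepPoly b s q r x l ≠ 0 := by
  cases x <;> simp only [twoStepPoly, cond_true, cond_false] at *
  · refine mul_ne_zero (mul_ne_zero (hq _) (hq _)) ?_
    rw [Ne, FaithfulSMul.algebraMap_eq_zero_iff]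
    exact inv_ne_zero (mul_ne_zero (fun h => hl (by linear_combination -h)) hs)
  · refine mul_ne_zero (mul_ne_zero (hq _) (hq _)) ?_
    rw [Ne, FaithfulSMul.algebraMap_eq_zero_iff]
    exact inv_ne_zero (mul_ne_zero (fun h => hl (by linear_combination h)) hs)

lemma exists_two_variables (S : Type u) [CommRing S] [Algebra F S] (y : Bool) (q₀ r₀ : F) :
    ∃ (q r : S[X][X]) (q' r' : S[X]) (ev₁ : S[X][X] →ₐ[F] S[X]) (ev₂ : S[X] →ₐ[F] S),
      ev₁ q = q' ∧ ev₁ r = r' ∧ ev₂ q' = algebraMap F S q₀ ∧ ev₂ r' = algebraMap F S r₀ ∧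
      (∀ p, ev₁ (C p) = p) ∧ (∀ p, ev₂ (C p) = p) ∧ (bif y then q else r) = X ∧
      (bif !y then q' else r') = X ∧
      (bif y then q' else r') = algebraMap F S[X] (bif y then q₀ else r₀) := by
  have hev : ∀ (R : Type u) [CommRing R] [Algebra F R] (z : F),
      ∃ ev : R[X] →ₐ[F] R, ev X = algebraMap F R z ∧ ∀ p, ev (C p) = p := fun R _ _ z =>
    ⟨(Polynomial.aeval (algebraMap F R z) : R[X] →ₐ[R] R).restrictScalars F,
      aeval_X _, fun p => aeval_C _ _⟩
  obtain ⟨ev₁, h1, h1'⟩ := hev S[X] (bif y then q₀ else r₀)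
  obtain ⟨ev₂, h2, h2'⟩ := hev S (bif y then r₀ else q₀)
  cases y
  · exact ⟨C X, X, X, algebraMap F S[X] r₀, ev₁, ev₂, h1' _, h1, h2, ev₂.commutes _, h1', h2', rfl,
      rfl, rfl⟩
  · exact ⟨X, C X, algebraMap F S[X] q₀, X, ev₁, ev₂, h1, h1' _, ev₂.commutes _, h2, h1', h2', rfl,
      rfl, rfl⟩

lemma twoStepPoly_congr {R : Type*} [CommRing R] [Algebra F R] (b s : F) {q r q' r' : R}
    {x : Bool} (h : (bif x then q else r) = bif x then q' else r') (l : F) :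
    twoStepPoly b s q r x l = twoStepPoly b s q' r' x l := by
  cases x <;> simp_all [twoStepPoly]

lemma Generic.twoStep {n : ℕ} {θ θs : ℕ → F} {b s : F} (q₀ r₀ : F)
    (hb : ∀ j ≤ n + 1, θ j + θ (j + 1) = bif decide (Even j) then b else b - 1)
    (hs : ∀ j ≤ n + 1, θs j + θs (j + 1) = bif decide (Even j) then s else s - 1)
    (h1 : θs 1 = 0)
    (hθ : ∀ j ≤ n + 1, θ j ≠ θ (j + 1)) (hθs : ∀ j ≤ n + 1, θs j ≠ θs (j + 1))
    (hn : 1 ≤ n)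
    (hg1 : twoStepCoeff b s q₀ r₀ θ (n + 1) = 0) (hg2 : twoStepCoeff b s q₀ r₀ θ (n + 2) = 0)
    (hg : ∀ i, 1 ≤ i → i ≤ n → twoStepCoeff b s q₀ r₀ θ i ≠ 1)
    (hT : Generic F n (fun j => θ (j + 1)) (fun j => θs (j + 1))) :
    Generic F (n + 2) θ θs := by
  obtain ⟨S, _, _, _, T, h0, hz, hind, h⟩ := hT
  have hθs0 : θs 0 = s := by simpa [h1] using hs 0 (by omega)
  have hs0 : s ≠ 0 := by have := hθs 0 (by omega); rwa [hθs0, h1] at this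
  obtain ⟨y, hy⟩ : ∃ y, y = decide (Even (n + 1)) := ⟨_, rfl⟩
  have hy' : decide (Even n) = !y := by
    rw [hy]; by_cases h : Even n <;> simp [h, Nat.even_add_one]
  obtain ⟨q, r, q', r', ev₁, ev₂, ev₁q, ev₁r, ev₂q, ev₂r, ev₁C, ev₂C, hX, hX', hι⟩ :=
    exists_two_variables S y q₀ r₀
  let g : ℕ → S[X][X] := fun i => twoStepPoly b s q r (decide (Even (i - 1))) (θ (i - 1))
  let g' : ℕ → S[X] := fun i => twoStepPoly b s q' r' (decide (Even (i - 1))) (θ (i - 1))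
  let c : ℕ → F := twoStepCoeff b s q₀ r₀ θ
  have hg₁ : ∀ i, ev₁ (g i) = g' i := fun i => by
    simp only [g, g', map_twoStepPoly, ev₁q, ev₁r]
  have hg₂ : ∀ i, ev₂ (g' i) = algebraMap F S (c i) := fun i => by
    simp only [g', map_twoStepPoly, ev₂q, ev₂r, twoStepPoly_algebraMap]; rfl
  let V : ℕ → S[X][X] := twoStepTail g (fun i => C (C (T i)))
  let V' : ℕ → S[X] := twoStepTail g' (fun i => C (T i))
  have hV₁ : ∀ i, ev₁ (V i) = V' i := fun i => by
    simp only [V, V', twoStepTail]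
    split_ifs <;> simp only [map_one, map_add, map_mul, map_sub, ev₁C, hg₁]
  have hV₂ : ∀ i, ev₂ (V' (i + 1)) =
      T (i + 1) + (T (i + 1 - 2) - T (i + 1)) * algebraMap F S (c (i + 1)) := fun i => by
    simp only [V', twoStepTail, if_neg (Nat.succ_ne_zero i), map_add, map_mul, map_sub, ev₂C, hg₂]
  have hT0 : ∀ i ≤ n, T i ≠ 0 := by
    intro i hi
    rcases i with _ | i
    · rw [h0]; exact one_ne_zero
    · exact hind.ne_zero ⟨i, hi⟩
  have hl : ∀ j ≤ n + 1, (bif decide (Even j) then b else b - 1) ≠ 2 * θ j := by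
    intro j hj h
    rw [← hb j hj] at h
    exact hθ j hj (by linear_combination -h)
  refine ⟨S[X][X], inferInstance, inferInstance, inferInstance, V, by simp [V, twoStepTail],
    ?_, ?_, ?_⟩
  · intro i hi
    simp only [V, twoStepTail, if_neg (show i ≠ 0 by omega), hz i (by omega),
      hz (i - 2) (by omega), map_zero, sub_self, zero_mul, add_zero]
  · refine AlgebraicIndependent.of_specialize ev₁ (Fin.last (n + 1)) ?_ ?_ ?_
    · simp only [Fin.succAbove_last, Fin.val_castSucc, hV₁]
      refine AlgebraicIndependent.of_specialize ev₂ (Fin.last n) ?_ ?_ ?_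
      · simp only [Fin.succAbove_last, Fin.val_castSucc, hV₂]
        refine algebraicIndependent_of_mem_adjoin hind ?_ ?_
        · have hmem : ∀ i ≤ n, T i ∈ Algebra.adjoin F (Set.range fun i : Fin n => T (i + 1)) := by
            intro i hi
            rcases i with _ | i
            · rw [h0]; exact one_mem _
            · exact Algebra.subset_adjoin ⟨⟨i, hi⟩, rfl⟩
          intro i
          exact add_mem (hmem _ i.2) (mul_mem (sub_mem (hmem _ (by omega)) (hmem _ i.2))
            (algebraMap_mem _ _))
        · set W : Fin n → S := fun i =>
            T (i + 1) + (T (i + 1 - 2) - T (i + 1)) * algebraMap F S (c (i + 1)) with hW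
          have hmem : ∀ i ≤ n, T i ∈ Algebra.adjoin F (Set.range W) := by
            intro i
            induction i using Nat.strong_induction_on with
            | _ i ih =>
              intro hi
              rcases i with _ | i
              · rw [h0]; exact one_mem _
              · have h1 := ih (i + 1 - 2) (by omega) (by omega)
                have h2 : W ⟨i, hi⟩ ∈ Algebra.adjoin F (Set.range W) :=
                  Algebra.subset_adjoin ⟨_, rfl⟩
                have hc : 1 - c (i + 1) ≠ 0 :=
                  sub_ne_zero.2 (hg (i + 1) (by omega) hi).symm
                have h3 : T (i + 1) = algebraMap F S (1 - c (i + 1))⁻¹ *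
                    (W ⟨i, hi⟩ - T (i + 1 - 2) * algebraMap F S (c (i + 1))) := by
                  have h4 : W ⟨i, hi⟩ - T (i + 1 - 2) * algebraMap F S (c (i + 1)) =
                      algebraMap F S (1 - c (i + 1)) * T (i + 1) := by
                    simp only [hW, map_sub, map_one]; ring
                  rw [h4, ← mul_assoc, ← map_mul, inv_mul_cancel₀ hc, map_one, one_mul]
                rw [h3]
                exact mul_mem (algebraMap_mem _ _) (sub_mem h2
                  (mul_mem h1 (algebraMap_mem _ _)))
          exact fun i => hmem _ i.2
      · simp only [Fin.val_last, hV₂, c, hg1, hz (n + 1) (by omega)]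
        simp
      · simp only [Fin.val_last, V', twoStepTail, if_neg (Nat.succ_ne_zero n),
          hz (n + 1) (by omega), map_zero, zero_add, sub_zero]
        refine mul_ne_zero (C_ne_zero.2 (hT0 _ (by omega))) (twoStepPoly_ne_zero hs0 ?_ ?_)
        · intro a
          rw [Nat.add_sub_cancel, hy', hX', IsScalarTower.algebraMap_apply F S S[X]]
          exact X_add_C_ne_zero _
        · exact hl n (by omega)
    · simp only [Fin.val_last, hV₁]
      have hg' : g' (n + 1 + 1) = algebraMap F S[X] (c (n + 2)) := by
        simp only [g', c, twoStepCoeff, ← twoStepPoly_algebraMap, ← hy,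
          show n + 2 - 1 = n + 1 from rfl]
        apply twoStepPoly_congr
        rw [hι]
        cases y <;> rfl
      simp only [V', twoStepTail, if_neg (Nat.succ_ne_zero (n + 1)), hz (n + 1 + 1) (by omega),
        hg', c, hg2, map_zero, mul_zero, add_zero]
    · simp only [Fin.val_last, V, twoStepTail, if_neg (Nat.succ_ne_zero (n + 1)),
        hz (n + 1 + 1) (by omega), map_zero, zero_add, sub_zero]
      refine mul_ne_zero (C_ne_zero.2 (C_ne_zero.2 (hT0 _ (by omega))))
        (twoStepPoly_ne_zero hs0 ?_ ?_)
      · intro a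
        rw [Nat.add_sub_cancel, ← hy, hX, IsScalarTower.algebraMap_apply F S[X] S[X][X]]
        exact X_add_C_ne_zero _
      · exact hl (n + 1) le_rfl
  · intro L _ _ _ φ hφ
    have hC : Function.Injective ((φ.comp (Polynomial.CAlgHom (R := F) (A := S[X]))).comp
        (Polynomial.CAlgHom (R := F) (A := S))) :=
      (hφ.comp C_injective).comp C_injective
    have hinj : Function.Injective (algebraMap F L) := (algebraMap F L).injective
    have hR := realizable_twoStep (θ := fun i => algebraMap F L (θ i))
      (θs := fun i => algebraMap F L (θs i)) (q := φ q) (r := φ r) (b := algebraMap F L b)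
      (s := algebraMap F L s) (n := n)
      (fun i hi => by rw [← map_add, hb i hi, Bool.apply_cond (algebraMap F L), map_sub, map_one])
      (fun i hi => by rw [← map_add, hs i hi, Bool.apply_cond (algebraMap F L), map_sub, map_one])
      (by rw [h1, map_zero])
      (fun j hj => hinj.ne (hθ j hj)) (fun j hj => hinj.ne (hθs j hj))
      (h L inferInstance inferInstance inferInstance _ hC)
    convert hR using 2 with i
    simp only [V, twoStepTail]
    split_ifs
    · simp
    · simp only [g, map_add, map_sub, map_mul, map_twoStepPoly, twoStepPoly_eq_twoStepFrac]
      rfl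

end GenericTwoStep

section Recurrent
variable {F : Type u} [Field F]

/-- A sequence of distinct scalars satisfying the three-term-difference recurrence. -/
structure IsRecurrent (B : F) (d : ℕ) (θ : ℕ → F) : Prop where
  ne : ∀ i ≤ d, ∀ j ≤ d, i ≠ j → θ i ≠ θ j
  sub : ∀ i, i + 3 ≤ d → θ i - θ (i + 3) = B * (θ (i + 1) - θ (i + 2))

lemma IsRecurrent.affine {B a c : F} {d : ℕ} {θ : ℕ → F} (ha : a ≠ 0) (h : IsRecurrent B d θ) :
    IsRecurrent B d (fun j => a * θ j + c) where
  ne i hi j hj hij e := h.ne i hi j hj hij (mul_left_cancel₀ ha (add_right_cancel e))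
  sub i hi := by linear_combination a * h.sub i hi

lemma IsRecurrent.pairSum {B : F} {d : ℕ} {θ : ℕ → F} (hB : B + 1 ≠ 0) (hd : d ≤ 4)
    (h : IsRecurrent B (d + 1) θ) : IsRecurrent B d (fun j => θ j + θ (j + 1)) where
  ne := by
    have hne : ∀ {i j}, i ≤ d + 1 → j ≤ d + 1 → i ≠ j → θ i - θ j ≠ 0 := fun hi hj hij =>
      sub_ne_zero.2 (h.ne _ hi _ hj hij)
    have key : ∀ i j, j ≤ d → i < j → θ i + θ (i + 1) ≠ θ j + θ (j + 1) := by
      intro i j hj hij e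
      obtain rfl | rfl | rfl | rfl : j = i + 1 ∨ j = i + 2 ∨ j = i + 3 ∨ j = i + 4 := by omega
      · exact hne (i := i) (j := i + 2) (by omega) (by omega) (by omega) (by linear_combination e)
      · refine mul_ne_zero hB (hne (i := i + 1) (j := i + 2) (by omega) (by omega) (by omega)) ?_
        linear_combination e - h.sub i (by omega)
      · have hB0 : B ≠ 0 := by
          rintro rfl
          exact hne (i := i) (j := i + 3) (by omega) (by omega) (by omega)
            (by linear_combination h.sub i (by omega))
        refine mul_ne_zero hB0 (hne (i := i + 1) (j := i + 3) (by omega) (by omega) (by omega)) ?_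
        linear_combination e - h.sub i (by omega) - h.sub (i + 1) (by omega)
      · have hB1 : B - 1 ≠ 0 := by
          intro hB1
          exact hne (i := i) (j := i + 4) (by omega) (by omega) (by omega)
            (by linear_combination h.sub i (by omega) + h.sub (i + 1) (by omega) +
              (θ (i + 1) - θ (i + 3)) * hB1)
        refine mul_ne_zero (mul_ne_zero hB hB1)
          (hne (i := i + 2) (j := i + 3) (by omega) (by omega) (by omega)) ?_
        linear_combination e - h.sub i (by omega) - (B + 1) * h.sub (i + 1) (by omega) -
          h.sub (i + 2) (by omega)
    intro i hi j hj hij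
    rcases lt_or_gt_of_ne hij with hlt | hlt
    · exact key i j hj hlt
    · exact (key j i hi hlt).symm
  sub i hi := by
    linear_combination h.sub i (by omega) + h.sub (i + 1) (by omega)

lemma Generic.of_isRecurrent {B : F} (hB : B + 1 ≠ 0) {d : ℕ} (hd : d ≤ 5) {θ θs : ℕ → F}
    (h : IsRecurrent B d θ) (hs : IsRecurrent B d θs) : Generic F d θ θs := by
  induction d generalizing θ θs with
  | zero => exact Generic.zero _ _
  | succ n ih =>
    have hκ : (B + 1)⁻¹ * (B + 1) = 1 := inv_mul_cancel₀ hB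
    have hne : ∀ {i j}, i ≤ n + 1 → j ≤ n + 1 → i ≠ j → θ i - θ j ≠ 0 := fun hi hj hij =>
      sub_ne_zero.2 (h.ne _ hi _ hj hij)
    have hnes : ∀ {i j}, i ≤ n + 1 → j ≤ n + 1 → i ≠ j → θs i - θs j ≠ 0 := fun hi hj hij =>
      sub_ne_zero.2 (hs.ne _ hi _ hj hij)
    set κ := (B + 1)⁻¹ with hκdef
    have hκ0 : κ ≠ 0 := inv_ne_zero hB
    obtain ⟨ρ, hρ⟩ : ∃ ρ, ρ = κ * (θs 0 - θs 2) / (θs 0 - θs 1) := ⟨_, rfl⟩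
    have h01 : θs 0 - θs 1 ≠ 0 := hnes (by omega) (by omega) (by omega)
    have hρ' : ρ * (θs 0 - θs 1) = κ * (θs 0 - θs 2) := by
      rw [hρ]; exact div_mul_cancel₀ _ h01
    have hwt : ∀ z j, oneStepWeight κ θ θs z j = (θ 0 - θ (j + 1) + z +
        (θ j + θ (j + 1) - θ 0 - θ 1) * ρ) / (θ j - θ (j + 1)) := by
      intro z j; rw [hρ]; rfl
    refine Generic.oneStep (B := B) (κ := κ)
      (θ n - θ 0 - (θ n + θ (n + 1) - θ 0 - θ 1) * ρ) hκ
      (fun i hi => h.sub i (by omega)) (fun i hi => hs.sub i (by omega))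
      (fun j hj => h.ne _ (by omega) _ (by omega) (by omega))
      (fun j hj => hs.ne _ (by omega) _ (by omega) (by omega))
      (fun j hj => h.ne _ (by omega) _ (by omega) (by omega))
      (fun j hj => hs.ne _ (by omega) _ (by omega) (by omega)) ?_ ?_
      (ih (by omega) (h.pairSum hB (by omega)) (hs.pairSum hB (by omega)))
    · rw [hwt, div_eq_one_iff_eq (hne (by omega) (by omega) (by omega))]
      ring
    · intro i hi
      rw [hwt]
      refine div_ne_zero ?_ (hne (by omega) (by omega) (by omega))
      intro e
      obtain rfl | rfl | rfl | rfl : n = i + 1 ∨ n = i + 2 ∨ n = i + 3 ∨ n = i + 4 := by omega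
      · refine mul_ne_zero (mul_ne_zero (hne (i := i) (j := i + 2) (by omega) (by omega)
          (by omega)) hκ0) (hnes (i := 0) (j := 2) (by omega) (by omega) (by omega)) ?_
        linear_combination (θs 0 - θs 1) * e - (θ i - θ (i + 2)) * hρ'
      · refine mul_ne_zero (hne (i := i + 1) (j := i + 2) (by omega) (by omega)
          (by omega)) (hnes (i := 1) (j := 2) (by omega) (by omega) (by omega)) ?_
        linear_combination (θs 0 - θs 1) * e - (B + 1) * (θ (i + 1) - θ (i + 2)) * hρ' -
          (θs 0 - θs 2) * (θ (i + 1) - θ (i + 2)) * hκ -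
          ρ * (θs 0 - θs 1) * h.sub i (by omega)
      · refine mul_ne_zero (mul_ne_zero (hne (i := i + 1) (j := i + 3) (by omega) (by omega)
          (by omega)) hκ0) (hnes (i := 1) (j := 3) (by omega) (by omega) (by omega)) ?_
        linear_combination (θs 0 - θs 1) * e - B * (θ (i + 1) - θ (i + 3)) * hρ' -
          ρ * (θs 0 - θs 1) * (h.sub i (by omega) + h.sub (i + 1) (by omega)) -
          (θ (i + 1) - θ (i + 3)) * (θs 0 - θs 1) * hκ +
          κ * (θ (i + 1) - θ (i + 3)) * hs.sub 0 (by omega)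
      · obtain rfl : i = 0 := by omega
        refine mul_ne_zero (hne (i := 2) (j := 3) (by omega) (by omega)
          (by omega)) (hnes (i := 2) (j := 3) (by omega) (by omega) (by omega)) ?_
        have h0 := h.sub 0 (by omega)
        have h1 := h.sub 1 (by omega)
        have h2 := h.sub 2 (by omega)
        have hs0 := hs.sub 0 (by omega)
        simp only [zero_add, Nat.reduceAdd] at *
        linear_combination (θs 0 - θs 1) * e - (B ^ 2 - 1) * (θ 2 - θ 3) * hρ' -
          ρ * (θs 0 - θs 1) * (h0 + (B + 1) * h1 + h2) +
          (θs 0 - θs 1) * h1 -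
          (B - 1) * (θ 2 - θ 3) * (θs 0 - θs 2) * hκ +
          (θ 2 - θ 3) * hs0

end Recurrent

section RecurrentNegOne
variable {F : Type u} [Field F]

/-- A recurrent sequence for `-1`, normalized by an affine change of variable. -/
structure IsNormalized (d : ℕ) (θ : ℕ → F) : Prop extends IsRecurrent (-1) d θ where
  one : θ 1 = 0
  two : θ 2 = θ 0 - 1

lemma IsNormalized.add_succ {d : ℕ} {θ : ℕ → F} (h : IsNormalized d θ) :
    ∀ j, j + 1 ≤ d → θ j + θ (j + 1) = bif decide (Even j) then θ 0 else θ 0 - 1 := by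
  intro j
  induction j using Nat.strong_induction_on with
  | _ j ih =>
    intro hj
    rcases j with _ | _ | j
    · simp [h.one]
    · simp [h.one, h.two]
    · have h1 := ih j (by omega) (by omega)
      have h2 := h.sub j (by omega)
      have h3 : decide (Even (j + 2)) = decide (Even j) := by simp [Nat.even_add]
      rw [h3, ← h1]
      linear_combination -h2

lemma IsNormalized.three {d : ℕ} {θ : ℕ → F} (h : IsNormalized d θ) (hd : 3 ≤ d) : θ 3 = 1 := by
  linear_combination (-1 : F) * h.sub 0 hd + h.one - h.two

lemma IsNormalized.four {d : ℕ} {θ : ℕ → F} (h : IsNormalized d θ) (hd : 4 ≤ d) :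
    θ 4 = θ 0 - 2 := by
  have h1 := h.sub 1 (by omega)
  simp only [Nat.reduceAdd, h.one, h.two, h.three (by omega)] at h1
  linear_combination -h1

lemma IsNormalized.five {d : ℕ} {θ : ℕ → F} (h : IsNormalized d θ) (hd : 5 ≤ d) : θ 5 = 2 := by
  have h1 := h.sub 2 (by omega)
  simp only [Nat.reduceAdd, h.two, h.three (by omega), h.four (by omega)] at h1
  linear_combination -h1

lemma Generic.of_isNormalized {d : ℕ} (hd : 3 ≤ d) (hd' : d ≤ 5) {θ θs : ℕ → F}
    (h : IsNormalized d θ) (hs : IsNormalized d θs)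
    (hT : Generic F (d - 2) (fun j => θ (j + 1)) (fun j => θs (j + 1))) : Generic F d θ θs := by
  have hne : ∀ i j, i ≤ d → j ≤ d → i ≠ j → θ i - θ j ≠ 0 := fun i j hi hj hij =>
    sub_ne_zero.2 (h.ne _ hi _ hj hij)
  have hnes : ∀ i j, i ≤ d → j ≤ d → i ≠ j → θs i - θs j ≠ 0 := fun i j hi hj hij =>
    sub_ne_zero.2 (hs.ne _ hi _ hj hij)
  have hb0 := hne 0 1 (by omega) (by omega) (by omega)
  have hb1 := hne 2 1 (by omega) (by omega) (by omega)
  have hs0 := hnes 0 1 (by omega) (by omega) (by omega)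
  have hs1 := hnes 2 1 (by omega) (by omega) (by omega)
  simp only [h.one, hs.one, h.two, hs.two, sub_zero] at hb0 hb1 hs0 hs1
  have h1 : (1 - θ 0) * θs 0 ≠ 0 := mul_ne_zero (by rwa [← neg_ne_zero, neg_sub]) hs0
  have h0 : (θ 0 - 2 * θ 0) * θs 0 ≠ 0 :=
    mul_ne_zero (fun e => hb0 (by linear_combination -e)) hs0
  obtain ⟨n, rfl⟩ : ∃ n, d = n + 2 := ⟨d - 2, by omega⟩
  have key : ∀ q₀ r₀ : F, twoStepCoeff (θ 0) (θs 0) q₀ r₀ θ (n + 1) = 0 →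
      twoStepCoeff (θ 0) (θs 0) q₀ r₀ θ (n + 2) = 0 →
      (∀ i, 1 ≤ i → i ≤ n → twoStepCoeff (θ 0) (θs 0) q₀ r₀ θ i ≠ 1) → Generic F (n + 2) θ θs :=
    fun q₀ r₀ hg1 hg2 hg => Generic.twoStep q₀ r₀ (fun j hj => h.add_succ j (by omega))
      (fun j hj => hs.add_succ j (by omega)) hs.one
      (fun j hj => h.ne _ (by omega) _ (by omega) (by omega))
      (fun j hj => hs.ne _ (by omega) _ (by omega) (by omega)) (by omega) hg1 hg2 hg hT
  obtain rfl | rfl | rfl : n = 1 ∨ n = 2 ∨ n = 3 := by omega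
  · refine key (-1) 0 ?_ ?_ ?_
    · simp [twoStepCoeff, twoStepFrac, h.one]
    · simp only [twoStepCoeff, twoStepFrac, Nat.reduceAdd, Nat.reduceSub, h.two, even_two,
        decide_true, cond_true]
      ring
    · intro i hi hi'
      obtain rfl : i = 1 := by omega
      simp only [twoStepCoeff, twoStepFrac, Nat.sub_self, Even.zero, decide_true, cond_true]
      rw [Ne, div_eq_one_iff_eq h0]
      intro e
      exact mul_ne_zero hb1 hs1 (by linear_combination e)
  · have hb2 := hne 4 1 (by omega) (by omega) (by omega)
    simp only [h.one, h.four le_rfl, sub_zero] at hb2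
    refine key (-1) (-1) ?_ ?_ ?_
    · simp only [twoStepCoeff, twoStepFrac, Nat.reduceAdd, Nat.reduceSub, h.two, even_two,
        decide_true, cond_true]
      ring
    · simp [twoStepCoeff, twoStepFrac, h.three, show ¬ Even 3 by decide]
    · intro i hi hi'
      obtain rfl | rfl : i = 1 ∨ i = 2 := by omega
      · simp only [twoStepCoeff, twoStepFrac, Nat.sub_self, Even.zero, decide_true, cond_true]
        rw [Ne, div_eq_one_iff_eq h0]
        intro e
        exact mul_ne_zero hb1 hs1 (by linear_combination e)
      · simp only [twoStepCoeff, twoStepFrac, Nat.reduceSub, h.one, Nat.not_even_one,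
          decide_false, cond_false, mul_zero, zero_add, add_zero, sub_zero]
        rw [Ne, div_eq_one_iff_eq h1]
        intro e
        exact mul_ne_zero hb2 hs1 (by linear_combination e)
  · have hb2 := hne 4 1 (by omega) (by omega) (by omega)
    have hs2 := hnes 4 1 (by omega) (by omega) (by omega)
    have hb3 := hne 2 5 (by omega) (by omega) (by omega)
    simp only [h.one, hs.one, h.two, h.four, hs.four, h.five, sub_zero, le_refl, Nat.reduceAdd,
      Nat.reduceLeDiff] at hb2 hs2 hb3
    have h2 : (2 * (θ 0 - 1) - θ 0) * θs 0 ≠ 0 :=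
      mul_ne_zero (fun e => hb2 (by linear_combination e)) hs0
    refine key (-2) (-1) ?_ ?_ ?_
    · simp [twoStepCoeff, twoStepFrac, h.three, show ¬ Even 3 by decide]
    · simp only [twoStepCoeff, twoStepFrac, Nat.reduceAdd, Nat.reduceSub, h.four,
        show Even 4 by decide, decide_true, cond_true, Nat.reduceLeDiff]
      ring
    · intro i hi hi'
      obtain rfl | rfl | rfl : i = 1 ∨ i = 2 ∨ i = 3 := by omega
      · simp only [twoStepCoeff, twoStepFrac, Nat.sub_self, Even.zero, decide_true, cond_true]
        rw [Ne, div_eq_one_iff_eq h0]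
        intro e
        exact mul_ne_zero hb2 hs2 (by linear_combination e)
      · simp only [twoStepCoeff, twoStepFrac, Nat.reduceSub, h.one, Nat.not_even_one,
          decide_false, cond_false, mul_zero, zero_add, add_zero, sub_zero]
        rw [Ne, div_eq_one_iff_eq h1]
        intro e
        exact mul_ne_zero hb2 hs1 (by linear_combination e)
      · simp only [twoStepCoeff, twoStepFrac, Nat.reduceSub, h.two, even_two,
          decide_true, cond_true]
        rw [Ne, div_eq_one_iff_eq (fun e => h2 (by linear_combination -e))]
        intro e
        exact mul_ne_zero hb3 hs1 (by linear_combination e)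

lemma IsRecurrent.isNormalized {d : ℕ} (hd : 2 ≤ d) {θ : ℕ → F} (h : IsRecurrent (-1) d θ) :
    IsNormalized d (fun j => (θ 0 - θ 2)⁻¹ * θ j + -((θ 0 - θ 2)⁻¹ * θ 1)) where
  toIsRecurrent := h.affine
    (inv_ne_zero (sub_ne_zero.2 (h.ne _ (by omega) _ (by omega) (by omega))))
  one := by ring
  two := by
    have := inv_mul_cancel₀ (sub_ne_zero.2 (h.ne 0 (by omega) 2 (by omega) (by omega)))
    linear_combination -this

lemma IsRecurrent.generic_neg_one {d : ℕ} (hd : d ≤ 5) {θ θs : ℕ → F}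
    (h : IsRecurrent (-1) d θ) (hs : IsRecurrent (-1) d θs) : Generic F d θ θs := by
  induction d using Nat.strong_induction_on generalizing θ θs with
  | _ d ih =>
    rcases lt_or_ge d 3 with hd3 | hd3
    · refine Generic.of_isRecurrent (B := 0) (by simp) hd ⟨h.ne, fun i hi => by omega⟩
        ⟨hs.ne, fun i hi => by omega⟩
    · have H := h.isNormalized (by omega)
      have Hs := hs.isNormalized (by omega)
      have hT := ih (d - 2) (by omega) (by omega)
        (θ := fun j => (θ 0 - θ 2)⁻¹ * θ (j + 1) + -((θ 0 - θ 2)⁻¹ * θ 1))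
        (θs := fun j => (θs 0 - θs 2)⁻¹ * θs (j + 1) + -((θs 0 - θs 2)⁻¹ * θs 1))
        ⟨fun i hi j hj hij => H.ne (i + 1) (by omega) (j + 1) (by omega) (by omega),
          fun i hi => H.sub (i + 1) (by omega)⟩
        ⟨fun i hi j hj hij => Hs.ne (i + 1) (by omega) (j + 1) (by omega) (by omega),
          fun i hi => Hs.sub (i + 1) (by omega)⟩
      refine (Generic.of_isNormalized hd3 hd H Hs hT).affine (a := θ 0 - θ 2) (c := θ 1)
        (a' := θs 0 - θs 2) (c' := θs 1) (fun i _ => ?_) (fun i _ => ?_)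
      · have := mul_inv_cancel₀ (sub_ne_zero.2 (h.ne 0 (by omega) 2 (by omega) (by omega)))
        linear_combination (θ 1 - θ i) * this
      · have := mul_inv_cancel₀ (sub_ne_zero.2 (hs.ne 0 (by omega) 2 (by omega) (by omega)))
        linear_combination (θs 1 - θs i) * this

lemma Generic.of_isRecurrent' {B : F} {d : ℕ} (hd : d ≤ 5) {θ θs : ℕ → F}
    (h : IsRecurrent B d θ) (hs : IsRecurrent B d θs) : Generic F d θ θs := by
  by_cases hB : B + 1 = 0
  · obtain rfl := eq_neg_of_add_eq_zero_left hB
    exact h.generic_neg_one hd hs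
  · exact Generic.of_isRecurrent hB hd h hs

end RecurrentNegOne

section Final

lemma IsHalf.mul_pow_mul {A : Type u} [Ring A] {d : ℕ} {e : ℕ → A} {a : A} (h : IsHalf d e a)
    {i j k : ℕ} (hi : i ≤ d) (hj : j ≤ d) (hk : k < max (i - j) (j - i)) :
    e i * a ^ k * e j = 0 := by
  induction k generalizing j with
  | zero => rw [pow_zero, mul_one, h.mul_e i hi j hj, if_neg (by rintro rfl; simp at hk)]
  | succ k ih =>
    have h1 : e i * a ^ (k + 1) * e j =
        ∑ m ∈ range (d + 1), (e i * a ^ k) * e m * (a * e j) := by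
      rw [← Finset.sum_mul, ← Finset.mul_sum, h.sum_e, mul_one, pow_succ]
      simp only [mul_assoc]
    rw [h1]
    refine Finset.sum_eq_zero fun m hm => ?_
    rw [Finset.mem_range, Nat.lt_succ_iff] at hm
    by_cases hmj : m + 2 ≤ j ∨ j + 2 ≤ m
    · rw [mul_assoc, ← mul_assoc (e m), h.trid m hm j hj hmj, mul_zero]
    · rw [ih hm (by omega), zero_mul]

lemma aeval_eigenSum {L : Type u} [Field L] {A : Type u} [Ring A] [Algebra L A] {d : ℕ}
    {θ : ℕ → L} {e : ℕ → A} {a : A} (h : IsHalf d e a) (p : L[X]) :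
    aeval (eigenSum d θ e) p = eigenSum d (fun i => p.eval (θ i)) e := by
  induction p using Polynomial.induction_on' with
  | add p q hp hq =>
    rw [map_add, hp, hq]
    simp only [eigenSum, eval_add, add_smul, Finset.sum_add_distrib]
  | monomial n c =>
    simp only [aeval_monomial, eval_monomial]
    have hpow : ∀ n, eigenSum d θ e ^ n = eigenSum d (fun i => θ i ^ n) e := by
      intro n
      induction n with
      | zero => simp [eigenSum, h.sum_e]
      | succ n ih =>
        rw [pow_succ, ih]
        simp only [eigenSum, Finset.sum_mul_sum]
        refine Finset.sum_congr rfl fun i hi => ?_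
        rw [Finset.sum_eq_single i]
        · rw [smul_mul_smul_comm, h.mul_e i (by simpa [Nat.lt_succ_iff] using hi) i
            (by simpa [Nat.lt_succ_iff] using hi), if_pos rfl, pow_succ]
        · intro j hj hji
          rw [smul_mul_smul_comm, h.mul_e i (by simpa [Nat.lt_succ_iff] using hi) j
            (by simpa [Nat.lt_succ_iff] using hj), if_neg hji.symm, smul_zero]
        · exact fun h' => absurd hi h'
    rw [hpow, eigenSum, Finset.mul_sum, eigenSum]
    refine Finset.sum_congr rfl fun i _ => ?_
    rw [mul_smul_comm, mul_smul, Algebra.algebraMap_eq_smul_one, smul_mul_assoc, one_mul, smul_comm]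

lemma exists_algHom_of_isHalf {F : Type u} [Field F] {A : Type u} [Ring A] [Algebra F A] {d : ℕ}
    {θ θs : ℕ → F} {e es : ℕ → A} (h : IsHalf d e (eigenSum d θs es))
    (h' : IsHalf d es (eigenSum d θ e)) :
    ∃ Φ : TAlg F d θ θs →ₐ[F] A, Φ (aT F d θ θs) = eigenSum d θ e ∧ Φ (esT F d θ θs 0) = es 0 := by
  let f : TGen d → A := fun g => match g with
    | TGen.a => eigenSum d θ e
    | TGen.astar => eigenSum d θs es
    | TGen.e i => e i
    | TGen.estar i => es i
  have hf : ∀ ⦃x y⦄, TRel F d θ θs x y → FreeAlgebra.lift F f x = FreeAlgebra.lift F f y := by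
    intro x y hxy
    cases hxy with
    | ee i j =>
      rw [apply_ite (FreeAlgebra.lift F f)]
      simp only [map_mul, FreeAlgebra.lift_ι_apply, map_zero, f]
      rw [h.mul_e i (by omega) j (by omega)]
      simp only [Fin.ext_iff]
    | eses i j =>
      rw [apply_ite (FreeAlgebra.lift F f)]
      simp only [map_mul, FreeAlgebra.lift_ι_apply, map_zero, f]
      rw [h'.mul_e i (by omega) j (by omega)]
      simp only [Fin.ext_iff]
    | sum_e =>
      simp only [map_sum, map_one, FreeAlgebra.lift_ι_apply, f]
      rw [← h.sum_e, Finset.sum_range]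
    | sum_estar =>
      simp only [map_sum, map_one, FreeAlgebra.lift_ι_apply, f]
      rw [← h'.sum_e, Finset.sum_range]
    | a_eq =>
      simp only [map_sum, map_smul, FreeAlgebra.lift_ι_apply, f, eigenSum]
      rw [Finset.sum_range]
    | astar_eq =>
      simp only [map_sum, map_smul, FreeAlgebra.lift_ι_apply, f, eigenSum]
      rw [Finset.sum_range]
    | trid i j k hk hij =>
      simp only [map_mul, map_pow, map_zero, FreeAlgebra.lift_ι_apply, f]
      exact h'.mul_pow_mul (by omega) (by omega) hij
    | tridstar i j k hk hij =>
      simp only [map_mul, map_pow, map_zero, FreeAlgebra.lift_ι_apply, f]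
      exact h.mul_pow_mul (by omega) (by omega) hij
  refine ⟨RingQuot.liftAlgHom F ⟨FreeAlgebra.lift F f, hf⟩, ?_, ?_⟩
  · rw [aT, tgen, RingQuot.liftAlgHom_mkAlgHom_apply, FreeAlgebra.lift_ι_apply]
  · rw [esT, dif_pos (Nat.succ_pos d), tgen, RingQuot.liftAlgHom_mkAlgHom_apply,
      FreeAlgebra.lift_ι_apply]

lemma eval_tauPoly_of_lt {F : Type u} [Field F] (θ : ℕ → F) {i j : ℕ} (h : j < i) :
    (tauPoly θ i).eval (θ j) = 0 := by
  rw [tauPoly, eval_prod]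
  exact Finset.prod_eq_zero (Finset.mem_range.2 h) (by simp)

lemma eval_tauPoly_self_ne_zero {F : Type u} [Field F] {θ : ℕ → F} {i : ℕ}
    (h : ∀ j < i, θ i ≠ θ j) : (tauPoly θ i).eval (θ i) ≠ 0 := by
  rw [tauPoly, eval_prod, Finset.prod_ne_zero_iff]
  intro j hj
  simpa [sub_ne_zero] using h j (Finset.mem_range.1 hj)

lemma algebraicIndependent_tauPoly {F : Type u} [Field F] {S : Type u} [CommRing S] [IsDomain S]
    [Algebra F S] {d : ℕ} {θ : ℕ → F} {t : ℕ → S}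
    (hθ : ∀ i ≤ d, ∀ j ≤ d, i ≠ j → θ i ≠ θ j) (h0 : t 0 = 1) (hb : ∀ i, d < i → t i = 0)
    (ht : AlgebraicIndependent F (fun i : Fin d => t (i + 1))) :
    AlgebraicIndependent F (fun i : Fin d =>
      ∑ j ∈ range (d + 1), (tauPoly θ (i + 1)).eval (θ j) • (t j - t (j + 1))) := by
  refine algebraicIndependent_of_mem_adjoin ht ?_ ?_
  · have hmem : ∀ i, t i ∈ Algebra.adjoin F (Set.range fun i : Fin d => t (i + 1)) := by
      intro i
      rcases i with _ | i
      · rw [h0]; exact one_mem _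
      · rcases lt_or_ge i d with hi | hi
        · exact Algebra.subset_adjoin ⟨⟨i, hi⟩, rfl⟩
        · rw [hb _ (by omega)]; exact zero_mem _
    exact fun i => sum_mem fun j _ => Subalgebra.smul_mem _ (sub_mem (hmem _) (hmem _)) _
  · set V : Fin d → S := fun i =>
      ∑ j ∈ range (d + 1), (tauPoly θ (i + 1)).eval (θ j) • (t j - t (j + 1)) with hV
    have hmem : ∀ m i, 1 ≤ i → d + 1 ≤ i + m → t i ∈ Algebra.adjoin F (Set.range V) := by
      intro m
      induction m with
      | zero => intro i _ hi; rw [hb i (by omega)]; exact zero_mem _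
      | succ m ih =>
        intro i hi hm
        rcases lt_or_ge d i with hid | hid
        · rw [hb i hid]; exact zero_mem _
        obtain ⟨i, rfl⟩ : ∃ k, i = k + 1 := ⟨i - 1, by omega⟩
        have hc := eval_tauPoly_self_ne_zero (θ := θ) (i := i + 1)
          fun j hj => hθ _ hid j (by omega) (by omega)
        have h1 : V ⟨i, hid⟩ ∈ Algebra.adjoin F (Set.range V) := Algebra.subset_adjoin ⟨_, rfl⟩
        rw [hV] at h1
        simp only at h1
        rw [← Finset.add_sum_erase _ _ (Finset.mem_range.2 (Nat.lt_succ_of_le hid)), ← hV] at h1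
        have h2 := (add_mem_cancel_right (sum_mem fun j hj => ?_)).1 h1
        · have h3 := Subalgebra.smul_mem _ h2 ((tauPoly θ (i + 1)).eval (θ (i + 1)))⁻¹
          rw [inv_smul_smul₀ hc] at h3
          simpa using add_mem h3 (ih (i + 1 + 1) (by omega) (by omega))
        · rcases lt_trichotomy j (i + 1) with hj' | rfl | hj'
          · rw [eval_tauPoly_of_lt θ hj', zero_smul]
            exact zero_mem _
          · simp at hj
          · exact Subalgebra.smul_mem _ (sub_mem (ih _ (by omega) (by omega))
              (ih _ (by omega) (by omega))) _
    exact fun i => hmem d _ (by omega) (by omega)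

lemma injective_of_generic {F : Type u} [Field F] {d : ℕ} {θ θs : ℕ → F}
    (hθ : ∀ i ≤ d, ∀ j ≤ d, i ≠ j → θ i ≠ θ j) (h : Generic F d θ θs)
    (μ : MvPolynomial (Fin d) F →ₗ[F] TAlg F d θ θs) (hμ : MuProps F d θ θs μ) :
    Function.Injective μ := by
  obtain ⟨S, _, _, _, t, h0, hb, hind, h⟩ := h
  obtain ⟨hμ1, hμm, hμX, -⟩ := hμ
  let L := AlgebraicClosure (FractionRing S)
  let φ : S →ₐ[F] L := (IsScalarTower.toAlgHom F (FractionRing S) L).comp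
    (IsScalarTower.toAlgHom F S (FractionRing S))
  have hφ : Function.Injective φ :=
    (algebraMap (FractionRing S) L).injective.comp (IsFractionRing.injective S (FractionRing S))
  obtain ⟨A, _, _, e, es, hrep⟩ := h L inferInstance inferInstance inferInstance φ hφ
  let _ : Algebra F A := Algebra.compHom A (algebraMap F L)
  have : IsScalarTower F L A := IsScalarTower.of_algebraMap_eq fun _ => rfl
  have hsum : ∀ (θ : ℕ → F) (e : ℕ → A),
      eigenSum d (fun i => algebraMap F L (θ i)) e = eigenSum d θ e := fun θ e => by
    simp only [eigenSum, algebraMap_smul]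
  have half := hrep.half
  have half' := hrep.half'
  rw [hsum] at half half'
  obtain ⟨Φ, hΦa, hΦe⟩ := exists_algHom_of_isHalf half half'
  have hee : es 0 * es 0 = es 0 := by rw [half'.mul_e 0 (by omega) 0 (by omega), if_pos rfl]
  set x : Fin d → S := fun i =>
    ∑ j ∈ range (d + 1), (tauPoly θ (i + 1)).eval (θ j) • (t j - t (j + 1)) with hx
  have hΦX : ∀ i, Φ (μ (MvPolynomial.X i)) = φ (x i) • es 0 := by
    intro i
    rw [hμX, map_mul, map_mul, ← Polynomial.aeval_algHom_apply, hΦa, hΦe, aeval_eigenSum half,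
      eigenSum, Finset.mul_sum, Finset.sum_mul, hx, map_sum, Finset.sum_smul]
    refine Finset.sum_congr rfl fun j hj => ?_
    rw [mul_smul_comm, smul_mul_assoc, hrep.corner j (by simpa [Nat.lt_succ_iff] using hj),
      map_smul, map_sub, smul_assoc]
  have hΦμ : ∀ p, Φ (μ p) = φ (MvPolynomial.aeval x p) • es 0 := by
    intro p
    induction p using MvPolynomial.induction_on with
    | C c =>
      rw [← mul_one (MvPolynomial.C c), ← MvPolynomial.smul_eq_C_mul, map_smul, hμ1, map_smul, hΦe,
        map_smul, map_one, map_smul, map_one, smul_assoc, one_smul]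
    | add p q hp hq => simp only [map_add, hp, hq, add_smul]
    | mul_X p i hp =>
      rw [hμm, map_mul, hp, hΦX, smul_mul_smul_comm, hee, map_mul, map_mul, MvPolynomial.aeval_X]
  rw [injective_iff_map_eq_zero]
  intro p hp
  have h1 := hΦμ p
  rw [hp, map_zero, eq_comm, smul_eq_zero_iff_left hrep.ne_zero, map_eq_zero_iff φ hφ] at h1
  exact (injective_iff_map_eq_zero _).1 (algebraicIndependent_tauPoly hθ h0 hb hind) p h1

lemma EigCond.exists_isRecurrent {F : Type u} [Field F] {d : ℕ} {θ θs : ℕ → F}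
    (h : EigCond F d θ θs) : ∃ B : F, IsRecurrent B d θ ∧ IsRecurrent B d θs := by
  obtain ⟨h1, h2, β, hβ⟩ := h
  exact ⟨β, ⟨fun i hi j hj => h1 i j hi hj, fun i hi => (hβ (i + 2) (by omega) (by omega)).1⟩,
    ⟨fun i hi j hj => h2 i j hi hj, fun i hi => (hβ (i + 2) (by omega) (by omega)).2⟩⟩

end Final

/-- The `μ`-conjecture holds for `d ≤ 5`: the surjective `F`-algebra homomorphism
`μ : F[x_1,…,x_d] → e*_0 T e*_0`, `x_i ↦ e*_0 τ_i(a) e*_0`, is an isomorphism. -/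
theorem stmt19 {F : Type*} [Field F] (d : ℕ) (θ θs : ℕ → F) (h : EigCond F d θ θs)
    (hd : d ≤ 5)
    (μ : MvPolynomial (Fin d) F →ₗ[F] TAlg F d θ θs) (hμ : MuProps F d θ θs μ) :
    Function.Injective μ := by
  obtain ⟨B, h1, h2⟩ := h.exists_isRecurrent
  exact injective_of_generic h1.ne (Generic.of_isRecurrent' hd h1 h2) μ hμ
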